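/- arXiv:2407.19159 — 6 statements merged into one kernel-verified Lean document; each statement's English description precedes it below -/
import Mathlib

section
/- Let μ ∈ (0,1) and let (q(t),p(t)) be a solution of Hamilton's equations for the Jacobi Hamiltonian H with q(t) ≠ (−μ,0). Let R_t denote the rotation matrix [[cos t, −sin t],[sin t, cos t]], let J = [[0,1],[−1,0]], and set q̄(t) = R_{−t} q(t) and ē(t) = R_{−t}(−μ,0) (sidereal coordinates of the orbit and of the primary at (−μ,0)). Then for all t, (q̄(t)−ē(t))ᵀ J (d/dt)(q̄(t)−ē(t)) = (q₁(t)+μ)p₂(t) − q₂(t)p₁(t) − μ q₁(t) − μ². In particular, the argument of q̄(t)−ē(t) is strictly increasing at time t if and only if (q₁+μ)p₂ − q₂p₁ > μ(q₁+μ), and strictly decreasing if and only if (q₁+μ)p₂ − q₂p₁ < μ(q₁+μ). -/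
open Matrix Set

noncomputable section

/-- Phase space ℝ⁴. -/
abbrev V4 := Fin 4 → ℝ

/-- 2×2 real matrices. -/
abbrev M2 := Matrix (Fin 2) (Fin 2) ℝ

/-- Euclidean norm on ℝ⁴. -/
def enorm4 (v : V4) : ℝ := Real.sqrt (∑ i, (v i)^2)

/-- The gradient of `H : ℝ⁴ → ℝ` with respect to the standard Euclidean structure. -/
def gradient4 (H : V4 → ℝ) (x : V4) : V4 := fun i => fderiv ℝ H x (Pi.single i (1:ℝ))

/-- The Hamiltonian vector field of `H` with respect to the symplectic form `dw ∧ dz`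
in coordinates `(z₁, z₂, w₁, w₂)`:  ż = ∂H/∂w, ẇ = -∂H/∂z  (i.e. X_H = I₄∇H). -/
def symplGrad (H : V4 → ℝ) (x : V4) : V4 :=
  ![fderiv ℝ H x (Pi.single (2:Fin 4) (1:ℝ)), fderiv ℝ H x (Pi.single (3:Fin 4) (1:ℝ)),
    -fderiv ℝ H x (Pi.single (0:Fin 4) (1:ℝ)), -fderiv ℝ H x (Pi.single (1:Fin 4) (1:ℝ))]

/-- `γ : ℝ → ℝ⁴` is a solution of Hamilton's equations for `H` staying in the domain `D`. -/
def IsOrbit (H : V4 → ℝ) (D : Set V4) (γ : ℝ → V4) : Prop :=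
  ∀ t : ℝ, γ t ∈ D ∧ HasDerivAt γ (symplGrad H (γ t)) t

/-- The Jacobi Hamiltonian of the planar restricted three-body problem, in coordinates
`(q₁, q₂, p₁, p₂)`:  H = ½|p|² + q₁p₂ - q₂p₁ - (1-μ)/|q-(-μ,0)| - μ/|q-(1-μ,0)|. -/
def JacobiH (μ : ℝ) (x : V4) : ℝ :=
  (1/2) * ((x 2)^2 + (x 3)^2) + x 0 * x 3 - x 1 * x 2
    - (1 - μ) / Real.sqrt ((x 0 + μ)^2 + (x 1)^2)
    - μ / Real.sqrt ((x 0 - (1 - μ))^2 + (x 1)^2)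

/-- The domain of the Jacobi Hamiltonian: `q ∉ {(-μ,0), (1-μ,0)}`. -/
def JacobiDom (μ : ℝ) : Set V4 :=
  {x | (x 0, x 1) ≠ (-μ, 0) ∧ (x 0, x 1) ≠ (1 - μ, 0)}

/-- The set of critical values of the Jacobi Hamiltonian. -/
def JacobiCritVals (μ : ℝ) : Set ℝ :=
  {v | ∃ x ∈ JacobiDom μ, fderiv ℝ (JacobiH μ) x = 0 ∧ JacobiH μ x = v}

/-- The first critical energy `c₁(μ) = -H(L₁)`, where `H(L₁)` is the smallest critical
value of the Jacobi Hamiltonian. -/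
def firstCritEnergy (μ : ℝ) : ℝ := -sInf (JacobiCritVals μ)

/-- `|2z² - 1|` as a function of `(z₁, z₂)`, where `z = z₁ + i z₂`. -/
def lcAbs (z1 z2 : ℝ) : ℝ := Real.sqrt ((2*(z1^2 - z2^2) - 1)^2 + (4*z1*z2)^2)

/-- The domain of the Levi-Civita Hamiltonian: `2z² ≠ 1`. -/
def LCDom : Set V4 := {x | lcAbs (x 0) (x 1) ≠ 0}

/-- The Levi-Civita Hamiltonian `K_{μ,c}` in coordinates `(z₁, z₂, w₁, w₂)`. -/
def Kham (μ c : ℝ) (x : V4) : ℝ :=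
  (1/2) * ((x 2)^2 + (x 3)^2) + c * ((x 0)^2 + (x 1)^2) - (1 - μ)/2
    + 2 * ((x 0)^2 + (x 1)^2) * (x 0 * x 3 - x 1 * x 2)
    - μ * (x 0 * x 3 + x 1 * x 2)
    - μ * ((x 0)^2 + (x 1)^2) / lcAbs (x 0) (x 1)

/-- `Σ_{μ,c}`: the connected component of `K_{μ,c}⁻¹(0)` containing the circle
`{(0,w) : |w|² = 1-μ}` (we use the point `(0,0,√(1-μ),0)` of that circle). -/
def SigmaLC (μ c : ℝ) : Set V4 :=
  connectedComponentIn {x : V4 | x ∈ LCDom ∧ Kham μ c x = 0} ![0, 0, Real.sqrt (1 - μ), 0]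

/-- The anti-symplectic involution `R₊(z,w) = (z̄, -w̄)`. -/
def Rplus (x : V4) : V4 := ![x 0, -x 1, -x 2, x 3]

/-- The anti-symplectic involution `R₋(z,w) = (-z̄, w̄)`. -/
def Rminus (x : V4) : V4 := ![-x 0, x 1, x 2, -x 3]

/-- A `T`-periodic orbit of the Levi-Civita Hamiltonian flow lying on `Σ_{μ,c}`. -/
def IsClosedOrbit (μ c T : ℝ) (γ : ℝ → V4) : Prop :=
  0 < T ∧ IsOrbit (Kham μ c) LCDom γ ∧ (∀ t, γ (t + T) = γ t) ∧ ∀ t, γ t ∈ SigmaLC μ c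

/-- A `T`-periodic orbit is symmetric if, after a time shift, `γ(t) = R₊(γ(T-t))` for all `t`
or `γ(t) = R₋(γ(T-t))` for all `t`. -/
def IsSymmetricOrbit (T : ℝ) (γ : ℝ → V4) : Prop :=
  ∃ s : ℝ, (∀ t, γ (s + t) = Rplus (γ (s + (T - t))))
         ∨ (∀ t, γ (s + t) = Rminus (γ (s + (T - t))))

/-- An orbit `(z(t),w(t))` is retrograde if `z₁w₂ - z₂w₁ > μ(z₁² - z₂²)` along it. -/
def IsRetrograde (μ : ℝ) (γ : ℝ → V4) : Prop :=
  ∀ t : ℝ, μ * ((γ t 0)^2 - (γ t 1)^2) < γ t 0 * γ t 3 - γ t 1 * γ t 2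

/-- An orbit `(z(t),w(t))` is direct if `z₁w₂ - z₂w₁ < μ(z₁² - z₂²)` along it. -/
def IsDirect (μ : ℝ) (γ : ℝ → V4) : Prop :=
  ∀ t : ℝ, γ t 0 * γ t 3 - γ t 1 * γ t 2 < μ * ((γ t 0)^2 - (γ t 1)^2)

/-- The crossing number of a `T`-periodic orbit: `#{t ∈ [0,T) : z₁(t) = 0 or z₂(t) = 0}`. -/
def crossingNumber (T : ℝ) (γ : ℝ → V4) : ℕ :=
  {t ∈ Set.Ico (0:ℝ) T | γ t 0 = 0 ∨ γ t 1 = 0}.ncard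

/-- `γ'` is a reparametrization (time shift) of `γ`. -/
def IsTimeShift (γ γ' : ℝ → V4) : Prop := ∃ s : ℝ, ∀ t, γ' t = γ (t + s)

/-- The action `𝒜(γ) = ∫₀ᵀ (w·ż - z·ẇ) dt` of a `T`-periodic Levi-Civita orbit. -/
def orbitAction (μ c T : ℝ) (γ : ℝ → V4) : ℝ :=
  ∫ t in (0:ℝ)..T,
    (γ t 2 * symplGrad (Kham μ c) (γ t) 0 + γ t 3 * symplGrad (Kham μ c) (γ t) 1
      - γ t 0 * symplGrad (Kham μ c) (γ t) 2 - γ t 1 * symplGrad (Kham μ c) (γ t) 3)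

/-- Transverse non-degeneracy of a `T`-periodic orbit `γ` of `X_H` on a regular level set:
any `T`-periodic solution of the variational equation along `γ` starting tangent to the
level set is a multiple of the Hamiltonian vector field. -/
def TransverseNondeg (H : V4 → ℝ) (T : ℝ) (γ : ℝ → V4) : Prop :=
  ∀ v : ℝ → V4,
    (∀ t : ℝ, HasDerivAt v (fderiv ℝ (symplGrad H) (γ t) (v t)) t) →
    v T = v 0 →
    fderiv ℝ H (γ 0) (v 0) = 0 →
    ∃ a : ℝ, v 0 = a • symplGrad H (γ 0)

/-- `T` is the minimal period of `γ`. -/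
def IsMinimalPeriod (T : ℝ) (γ : ℝ → V4) : Prop :=
  0 < T ∧ (∀ t, γ (t + T) = γ t) ∧ ∀ T' : ℝ, 0 < T' → (∀ t, γ (t + T') = γ t) → T ≤ T'

/-- The quaternionic matrix `I₄`. -/
def I4 : Matrix (Fin 4) (Fin 4) ℝ := !![0,0,1,0; 0,0,0,1; -1,0,0,0; 0,-1,0,0]

/-- The quaternionic matrix `J₄`. -/
def J4 : Matrix (Fin 4) (Fin 4) ℝ := !![0,1,0,0; -1,0,0,0; 0,0,0,-1; 0,0,1,0]

/-- The quaternionic matrix `K₄`. -/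
def K4 : Matrix (Fin 4) (Fin 4) ℝ := !![0,0,0,-1; 0,0,1,0; 0,-1,0,0; 1,0,0,0]

/-- `Ω₂ = [[0,1],[-1,0]]`. -/
def Omega2 : M2 := !![0,1; -1,0]

/-- `Ω₄ = -I₄`. -/
def Omega4 : Matrix (Fin 4) (Fin 4) ℝ := -I4

/-- The 4×2 frame matrix `F(x) = [U(x) V(x)]` with `U = J₄∇H/‖∇H‖`, `V = K₄∇H/‖∇H‖`. -/
def frameF (H : V4 → ℝ) (x : V4) : Matrix (Fin 4) (Fin 2) ℝ :=
  Matrix.of fun i j =>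
    (if j = 0 then J4.mulVec (gradient4 H x) i else K4.mulVec (gradient4 H x) i)
      / enorm4 (gradient4 H x)

/-- `M` is the linearized flow `t ↦ dFl_t(γ(0))` along the orbit `γ` of `X_H`:
`M(0) = id` and each column solves the variational equation. -/
def IsLinearizedFlow (H : V4 → ℝ) (γ : ℝ → V4) (M : ℝ → Matrix (Fin 4) (Fin 4) ℝ) : Prop :=
  M 0 = 1 ∧ ∀ j : Fin 4, ∀ t : ℝ,
    HasDerivAt (fun s => fun i => M s i j)
      (fderiv ℝ (symplGrad H) (γ t) (fun i => M t i j)) t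

/-- The reduced monodromy path `Ψ(t) = Ω₂ᵀ F(γ(t))ᵀ Ω₄ M(t) F(γ(0))`. -/
def reducedMonodromy (H : V4 → ℝ) (γ : ℝ → V4)
    (M : ℝ → Matrix (Fin 4) (Fin 4) ℝ) (t : ℝ) : M2 :=
  Omega2ᵀ * (frameF H (γ t))ᵀ * Omega4 * M t * frameF H (γ 0)

/-- The retraction `ρ(Ψ) = (ΨΨᵀ)^{-1/2}Ψ` of `SL(2,ℝ)` onto `SO(2)`, written explicitly. -/
def rho (Ψ : M2) : M2 :=
  (1 / Real.sqrt ((Ψ 0 0 + Ψ 1 1)^2 + (Ψ 0 1 - Ψ 1 0)^2)) •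
    !![Ψ 0 0 + Ψ 1 1, Ψ 0 1 - Ψ 1 0; -(Ψ 0 1 - Ψ 1 0), Ψ 0 0 + Ψ 1 1]

/-- The rotation by angle `θ`. -/
def rotMat (θ : ℝ) : M2 := !![Real.cos θ, -Real.sin θ; Real.sin θ, Real.cos θ]

/-- The Conley-Zehnder index of the path `ψ : [0,T] → SL(2,ℝ)` equals `k`: there is a
continuous angle `θ` with `θ(0) = 0` lifting `t ↦ ρ(ψ(t))`, and `k` is the even integer
closest to `θ(T)/π` if `tr ψ(T) > 2`, the odd integer closest to `θ(T)/π` if `tr ψ(T) < 2`. -/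
def CZIndexIs (T : ℝ) (ψ : ℝ → M2) (k : ℤ) : Prop :=
  ∃ θ : ℝ → ℝ, ContinuousOn θ (Set.Icc 0 T) ∧ θ 0 = 0 ∧
    (∀ t ∈ Set.Icc (0:ℝ) T, rho (ψ t) = rotMat (θ t)) ∧
    (((2:ℝ) < (ψ T).trace ∧ Even k) ∨ ((ψ T).trace < 2 ∧ Odd k)) ∧
    |θ T / Real.pi - (k:ℝ)| < 1

end

theorem differentiableAt_jacobiH {μ : ℝ} {x : V4} (hx : x ∈ JacobiDom μ) :
    DifferentiableAt ℝ (JacobiH μ) x := by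
  have sq_add_sq_ne_zero : ∀ a b : ℝ, ¬(a = 0 ∧ b = 0) → a ^ 2 + b ^ 2 ≠ 0 := by
    intro a b hab h
    exact hab ⟨by nlinarith [sq_nonneg a, sq_nonneg b], by nlinarith [sq_nonneg a, sq_nonneg b]⟩
  have h₁ : (x 0 + μ) ^ 2 + (x 1) ^ 2 ≠ 0 := by
    refine sq_add_sq_ne_zero _ _ fun h => hx.1 ?_
    rw [Prod.mk.injEq]
    exact ⟨by linarith [h.1], h.2⟩
  have h₂ : (x 0 - (1 - μ)) ^ 2 + (x 1) ^ 2 ≠ 0 := by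
    refine sq_add_sq_ne_zero _ _ fun h => hx.2 ?_
    rw [Prod.mk.injEq]
    exact ⟨by linarith [h.1], h.2⟩
  have hs₁ : Real.sqrt ((x 0 + μ) ^ 2 + (x 1) ^ 2) ≠ 0 :=
    (Real.sqrt_ne_zero (by positivity)).2 h₁
  have hs₂ : Real.sqrt ((x 0 - (1 - μ)) ^ 2 + (x 1) ^ 2) ≠ 0 :=
    (Real.sqrt_ne_zero (by positivity)).2 h₂
  unfold JacobiH
  fun_prop (disch := assumption)

theorem symplGrad_jacobiH_zero {μ : ℝ} {x : V4} (hx : x ∈ JacobiDom μ) :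
    symplGrad (JacobiH μ) x 0 = x 2 - x 1 := by
  change fderiv ℝ (JacobiH μ) x (Pi.single 2 1) = _
  rw [← (differentiableAt_jacobiH hx).lineDeriv_eq_fderiv]
  refine HasLineDerivAt.lineDeriv ?_
  have h : HasDerivAt (fun s : ℝ => (1 / 2) * s ^ 2 + (x 2 - x 1) * s + JacobiH μ x)
      (x 2 - x 1) 0 := by
    refine HasDerivAt.congr_deriv (((((hasDerivAt_id' (0 : ℝ)).fun_pow 2).const_mul (1 / 2)).fun_add
      ((hasDerivAt_id' (0 : ℝ)).const_mul (x 2 - x 1))).add_const (JacobiH μ x)) ?_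
    simp
  refine h.congr_of_eventuallyEq (Filter.Eventually.of_forall fun s => ?_)
  simp [JacobiH]
  ring

theorem symplGrad_jacobiH_one {μ : ℝ} {x : V4} (hx : x ∈ JacobiDom μ) :
    symplGrad (JacobiH μ) x 1 = x 3 + x 0 := by
  change fderiv ℝ (JacobiH μ) x (Pi.single 3 1) = _
  rw [← (differentiableAt_jacobiH hx).lineDeriv_eq_fderiv]
  refine HasLineDerivAt.lineDeriv ?_
  have h : HasDerivAt (fun s : ℝ => (1 / 2) * s ^ 2 + (x 3 + x 0) * s + JacobiH μ x)
      (x 3 + x 0) 0 := by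
    refine HasDerivAt.congr_deriv (((((hasDerivAt_id' (0 : ℝ)).fun_pow 2).const_mul (1 / 2)).fun_add
      ((hasDerivAt_id' (0 : ℝ)).const_mul (x 3 + x 0))).add_const (JacobiH μ x)) ?_
    simp
  refine h.congr_of_eventuallyEq (Filter.Eventually.of_forall fun s => ?_)
  simp [JacobiH]
  ring

/-- The polar-coordinate identity `u v' - v u' = r² φ'`, with no regularity assumed of `r`. -/
theorem mul_deriv_sub_mul_deriv_of_polar {u v φ r : ℝ → ℝ} {u' v' φ' t : ℝ}
    (hu : ∀ s, u s = r s * Real.cos (φ s)) (hv : ∀ s, v s = r s * Real.sin (φ s))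
    (hu' : HasDerivAt u u' t) (hv' : HasDerivAt v v' t) (hφ : HasDerivAt φ φ' t) :
    u t * v' - v t * u' = r t ^ 2 * φ' := by
  have hzero : (fun s => v s * Real.cos (φ s) - u s * Real.sin (φ s)) = fun _ => 0 := by
    funext s
    rw [hu, hv]
    ring
  have hd := (hv'.fun_mul hφ.cos).fun_sub (hu'.fun_mul hφ.sin)
  rw [hzero] at hd
  have h := hd.unique (hasDerivAt_const t (0 : ℝ))
  rw [hu, hv] at h ⊢
  linear_combination r t * h + r t ^ 2 * φ' * Real.sin_sq_add_cos_sq (φ t)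

/-- For an orbit of the Jacobi Hamiltonian, with `u + iv = q̄ - ē` the
sidereal position relative to the primary at `(-μ,0)`, one has
`(q̄-ē)ᵀ J (d/dt)(q̄-ē) = (q₁+μ)p₂ - q₂p₁ - μq₁ - μ²`; in particular the argument of
`q̄ - ē` is strictly increasing at `t` iff `(q₁+μ)p₂ - q₂p₁ > μ(q₁+μ)` and strictly
decreasing iff `(q₁+μ)p₂ - q₂p₁ < μ(q₁+μ)`. -/
theorem statement0 (μ : ℝ) (hμ : μ ∈ Set.Ioo (0:ℝ) 1)
    (x : ℝ → V4) (hx : IsOrbit (JacobiH μ) (JacobiDom μ) x)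
    (u v : ℝ → ℝ)
    (hu : ∀ t, u t = Real.cos t * (x t 0 + μ) + Real.sin t * (x t 1))
    (hv : ∀ t, v t = -Real.sin t * (x t 0 + μ) + Real.cos t * (x t 1)) :
    (∀ t : ℝ, u t * deriv v t - v t * deriv u t
        = (x t 0 + μ) * x t 3 - x t 1 * x t 2 - μ * x t 0 - μ^2) ∧
    (∀ (t : ℝ) (φ r : ℝ → ℝ) (φ' : ℝ),
        (∀ s, u s = r s * Real.cos (φ s)) → (∀ s, v s = r s * Real.sin (φ s)) →
        (∀ s, 0 < r s) → HasDerivAt φ φ' t →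
        ((0 < φ' ↔ μ * (x t 0 + μ) < (x t 0 + μ) * x t 3 - x t 1 * x t 2) ∧
         (φ' < 0 ↔ (x t 0 + μ) * x t 3 - x t 1 * x t 2 < μ * (x t 0 + μ)))) := by
  have hder : ∀ t, ∃ u' v', HasDerivAt u u' t ∧ HasDerivAt v v' t ∧
      u t * v' - v t * u' = (x t 0 + μ) * x t 3 - x t 1 * x t 2 - μ * x t 0 - μ ^ 2 := by
    intro t
    obtain ⟨hdom, hxt⟩ := hx t
    have hq := hasDerivAt_pi.1 hxt
    have hq₁ := (hq 0).add_const μ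
    have hq₂ := hq 1
    rw [symplGrad_jacobiH_zero hdom] at hq₁
    rw [symplGrad_jacobiH_one hdom] at hq₂
    have hu' := ((Real.hasDerivAt_cos t).fun_mul hq₁).fun_add ((Real.hasDerivAt_sin t).fun_mul hq₂)
    have hv' := ((Real.hasDerivAt_sin t).fun_neg.fun_mul hq₁).fun_add
      ((Real.hasDerivAt_cos t).fun_mul hq₂)
    rw [← funext hu] at hu'
    rw [← funext hv] at hv'
    refine ⟨_, _, hu', hv', ?_⟩
    rw [hu, hv]
    linear_combination ((x t 0 + μ) * (x t 3 + x t 0) - x t 1 * (x t 2 - x t 1)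
      - (x t 0 + μ) ^ 2 - x t 1 ^ 2) * Real.sin_sq_add_cos_sq t
  refine ⟨fun t => ?_, fun t φ r φ' hru hrv hr hφ => ?_⟩
  · obtain ⟨u', v', hu', hv', h⟩ := hder t
    rw [hu'.deriv, hv'.deriv, h]
  · obtain ⟨u', v', hu', hv', h⟩ := hder t
    rw [mul_deriv_sub_mul_deriv_of_polar hru hrv hu' hv' hφ] at h
    have hr2 : 0 < r t ^ 2 := pow_pos (hr t) 2
    constructor
    · rw [← mul_pos_iff_of_pos_left hr2, h]
      constructor <;> intro <;> linarith
    · rw [← neg_pos, ← mul_pos_iff_of_pos_left hr2, mul_neg, h]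
      constructor <;> intro <;> linarith
end

section
/- For every ψ ∈ SL(2,ℝ) one has det(ψ − I) = 2 − tr(ψ). Consequently, the complement in SL(2,ℝ) of the Maslov cycle V = {ψ ∈ SL(2,ℝ) : det(ψ − I) = 0} consists of exactly two path-connected components, namely V₊ = {ψ ∈ SL(2,ℝ) : det(ψ−I) > 0} = {ψ ∈ SL(2,ℝ) : tr(ψ) < 2} and V₋ = {ψ ∈ SL(2,ℝ) : det(ψ−I) < 0} = {ψ ∈ SL(2,ℝ) : tr(ψ) > 2}. -/
open Matrix Set

/-- The 2×2 matrix with half-trace `s`, skew part `v`, and traceless symmetric part of polar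
coordinates `(r, θ)`. -/
noncomputable def polarMat (s v r θ : ℝ) : M2 :=
  !![s + r * Real.cos θ, r * Real.sin θ + v; r * Real.sin θ - v, s - r * Real.cos θ]

theorem det_polarMat (s v r θ : ℝ) : (polarMat s v r θ).det = s ^ 2 + v ^ 2 - r ^ 2 := by
  rw [polarMat, det_fin_two_of]
  linear_combination -r ^ 2 * Real.sin_sq_add_cos_sq θ

theorem trace_polarMat (s v r θ : ℝ) : (polarMat s v r θ).trace = 2 * s := by
  rw [polarMat, trace_fin_two_of]
  ring

theorem exists_eq_polarMat (A : M2) :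
    ∃ s v θ : ℝ, A = polarMat s v (Real.sqrt (s ^ 2 + v ^ 2 - A.det)) θ := by
  let z : ℂ := ⟨(A 0 0 - A 1 1) / 2, (A 0 1 + A 1 0) / 2⟩
  refine ⟨(A 0 0 + A 1 1) / 2, (A 0 1 - A 1 0) / 2, z.arg, ?_⟩
  have hr : Real.sqrt (((A 0 0 + A 1 1) / 2) ^ 2 + ((A 0 1 - A 1 0) / 2) ^ 2 - A.det) = ‖z‖ := by
    rw [Complex.norm_def, Complex.normSq_apply, det_fin_two]
    congr 1
    simp only [z]
    ring
  have hc : ‖z‖ * Real.cos z.arg = (A 0 0 - A 1 1) / 2 := Complex.norm_mul_cos_arg z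
  have hs : ‖z‖ * Real.sin z.arg = (A 0 1 + A 1 0) / 2 := Complex.norm_mul_sin_arg z
  rw [hr, polarMat, hc, hs]
  ext i j
  fin_cases i <;> fin_cases j <;> simp <;> ring

theorem continuous_polarMat {X : Type*} [TopologicalSpace X] {s v r θ : X → ℝ}
    (hs : Continuous s) (hv : Continuous v) (hr : Continuous r) (hθ : Continuous θ) :
    Continuous fun x => polarMat (s x) (v x) (r x) (θ x) := by
  refine continuous_matrix fun i j => ?_
  fin_cases i <;> fin_cases j <;> simp [polarMat] <;> fun_prop

theorem isPathConnected_det_one_two_lt_trace :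
    IsPathConnected {A : M2 | A.det = 1 ∧ 2 < A.trace} := by
  let f : ℝ × ℝ × ℝ → M2 := fun p =>
    polarMat p.1 p.2.1 (Real.sqrt (p.1 ^ 2 + p.2.1 ^ 2 - 1)) p.2.2
  have hf : Continuous f := continuous_polarMat (by fun_prop) (by fun_prop) (by fun_prop)
    (by fun_prop)
  have hD : IsPathConnected (Ioi (1 : ℝ) ×ˢ (univ : Set (ℝ × ℝ))) :=
    ((convex_Ioi 1).prod convex_univ).isPathConnected ⟨(2, 0), by simp⟩
  convert hD.image hf using 1
  ext A
  constructor
  · rintro ⟨hdet, htr⟩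
    obtain ⟨s, v, θ, hA⟩ := exists_eq_polarMat A
    rw [hdet] at hA
    rw [hA, trace_polarMat] at htr
    exact ⟨(s, v, θ), ⟨by simp only [mem_Ioi]; linarith, mem_univ _⟩, hA.symm⟩
  · rintro ⟨⟨s, v, θ⟩, ⟨hs, -⟩, rfl⟩
    simp only [mem_Ioi] at hs
    refine ⟨?_, ?_⟩
    · simp only [f]
      rw [det_polarMat, Real.sq_sqrt (by nlinarith [sq_nonneg v])]
      ring
    · simp only [f]
      rw [trace_polarMat]
      linarith

theorem isPathConnected_det_one_trace_lt_two :
    IsPathConnected {A : M2 | A.det = 1 ∧ A.trace < 2} := by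
  -- The projection from `(1, 0)`, with slope `m = v / (1 - s)`, turns the region
  -- `s < 1 ≤ s ^ 2 + v ^ 2` into the half-plane `0 ≤ k`.
  let w : ℝ × ℝ × ℝ → ℝ := fun p => 2 / (p.1 ^ 2 + 1) + p.2.1
  let f : ℝ × ℝ × ℝ → M2 := fun p =>
    polarMat (1 - w p) (p.1 * w p) (Real.sqrt (w p * p.2.1 * (p.1 ^ 2 + 1))) p.2.2
  have hw : Continuous w :=
    (continuous_const.div (by fun_prop) fun p => by positivity).add (by fun_prop)
  have hf : Continuous f := continuous_polarMat (by fun_prop) (by fun_prop) (by fun_prop)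
    (by fun_prop)
  have hD : IsPathConnected ((univ : Set ℝ) ×ˢ (Ici (0 : ℝ) ×ˢ (univ : Set ℝ))) :=
    (convex_univ.prod ((convex_Ici 0).prod convex_univ)).isPathConnected ⟨(0, 0, 0), by simp⟩
  convert hD.image hf using 1
  ext A
  constructor
  · rintro ⟨hdet, htr⟩
    obtain ⟨s, v, θ, hA⟩ := exists_eq_polarMat A
    rw [hdet] at hA
    have hs : 0 < 1 - s := by
      rw [hA, trace_polarMat] at htr
      linarith
    have hsv : 1 ≤ s ^ 2 + v ^ 2 := by
      have h := congrArg det hA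
      rw [hdet, det_polarMat] at h
      by_contra! hlt
      rw [Real.sqrt_eq_zero_of_nonpos (by linarith)] at h
      linarith
    have hm : (v / (1 - s)) ^ 2 + 1 = (v ^ 2 + (1 - s) ^ 2) / (1 - s) ^ 2 := by
      field_simp
    have hpos : 0 < v ^ 2 + (1 - s) ^ 2 := by positivity
    let k : ℝ := (1 - s) - 2 / ((v / (1 - s)) ^ 2 + 1)
    have hwk : w (v / (1 - s), k, θ) = 1 - s := by simp only [w, k]; ring
    have hk : (1 - s) * k * ((v / (1 - s)) ^ 2 + 1) = s ^ 2 + v ^ 2 - 1 := by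
      simp only [k, hm]
      field_simp
      ring
    refine ⟨(v / (1 - s), k, θ), ⟨mem_univ _, ?_, mem_univ _⟩, ?_⟩
    · by_contra! hneg
      simp only [mem_Ici, not_le] at hneg
      have := mul_neg_of_neg_of_pos (mul_neg_of_pos_of_neg hs hneg)
        (by positivity : 0 < (v / (1 - s)) ^ 2 + 1)
      linarith
    · simp only [f, hwk, hk, sub_sub_cancel, div_mul_cancel₀ v hs.ne']
      exact hA.symm
  · rintro ⟨⟨m, k, θ⟩, ⟨-, hk, -⟩, rfl⟩
    simp only [mem_Ici] at hk
    have hwm : w (m, k, θ) * (m ^ 2 + 1) = 2 + k * (m ^ 2 + 1) := by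
      simp only [w]
      field_simp
    have hwpos : 0 < w (m, k, θ) := by simp only [w]; positivity
    refine ⟨?_, ?_⟩
    · simp only [f]
      rw [det_polarMat, Real.sq_sqrt (by positivity)]
      linear_combination w (m, k, θ) * hwm
    · simp only [f]
      rw [trace_polarMat]
      linarith

theorem isPathConnected_subtype_setOf {X : Type*} [TopologicalSpace X] {p q : X → Prop}
    (h : IsPathConnected {x | p x ∧ q x}) : IsPathConnected {x : {x // p x} | q x.1} := by
  refine Topology.IsInducing.subtypeVal.isPathConnected_iff.2 ?_
  convert h using 1
  ext x
  exact ⟨fun ⟨y, hy, hyx⟩ => hyx ▸ ⟨y.2, hy⟩, fun ⟨hp, hq⟩ => ⟨⟨x, hp⟩, hq, rfl⟩⟩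

theorem det_sub_one_of_det_eq_one {ψ : M2} (h : ψ.det = 1) : (ψ - 1).det = 2 - ψ.trace := by
  rw [det_fin_two] at h
  simp only [det_fin_two, trace_fin_two, Matrix.sub_apply, one_apply_eq, ne_eq, zero_ne_one,
    one_ne_zero, not_false_eq_true, one_apply_ne]
  linear_combination h

/-- For `ψ ∈ SL(2,ℝ)`, `det(ψ - I) = 2 - tr ψ`; the complement of the
Maslov cycle `V = {det(ψ-I) = 0}` in `SL(2,ℝ)` consists of exactly the two
path-connected components `V₊ = {det(ψ-I) > 0} = {tr ψ < 2}` and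
`V₋ = {det(ψ-I) < 0} = {tr ψ > 2}`. -/
theorem statement1 :
    (∀ ψ : M2, ψ.det = 1 → (ψ - 1).det = 2 - ψ.trace) ∧
    (∀ Vp Vm : Set {A : M2 // A.det = 1},
      Vp = {ψ : {A : M2 // A.det = 1} | 0 < (ψ.1 - 1).det} →
      Vm = {ψ : {A : M2 // A.det = 1} | (ψ.1 - 1).det < 0} →
      Vp = {ψ : {A : M2 // A.det = 1} | ψ.1.trace < 2} ∧
      Vm = {ψ : {A : M2 // A.det = 1} | 2 < ψ.1.trace} ∧
      IsPathConnected Vp ∧ IsPathConnected Vm ∧ Disjoint Vp Vm ∧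
      Vp ∪ Vm = {ψ : {A : M2 // A.det = 1} | (ψ.1 - 1).det ≠ 0}) := by
  refine ⟨fun ψ => det_sub_one_of_det_eq_one, ?_⟩
  rintro _ _ rfl rfl
  have hp : {ψ : {A : M2 // A.det = 1} | 0 < (ψ.1 - 1).det} = {ψ | ψ.1.trace < 2} := by
    ext ψ
    simp only [mem_ofPred_eq, det_sub_one_of_det_eq_one ψ.2, sub_pos]
  have hm : {ψ : {A : M2 // A.det = 1} | (ψ.1 - 1).det < 0} = {ψ | 2 < ψ.1.trace} := by
    ext ψ
    simp only [mem_ofPred_eq, det_sub_one_of_det_eq_one ψ.2, sub_neg]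
  refine ⟨hp, hm, ?_, ?_, ?_, ?_⟩
  · rw [hp]
    exact isPathConnected_subtype_setOf isPathConnected_det_one_trace_lt_two
  · rw [hm]
    exact isPathConnected_subtype_setOf isPathConnected_det_one_two_lt_trace
  · refine disjoint_left.2 fun ψ h h' => ?_
    rw [mem_ofPred_eq] at h h'
    exact lt_asymm h h'
  · ext ψ
    simp only [mem_union, mem_ofPred_eq, ne_iff_lt_or_gt, or_comm]
end

section
/- Let Ψ = [[a,b],[c,d]] be a real 2×2 matrix with det Ψ = 1. Then (a+d)² + (b−c)² = a² + b² + c² + d² + 2 > 0, and (Ψ Ψᵀ)^{−1/2} Ψ = (1/√((a+d)² + (b−c)²)) · [[a+d, b−c],[−(b−c), a+d]], where (Ψ Ψᵀ)^{1/2} denotes the unique positive-definite symmetric square root of the positive-definite symmetric matrix Ψ Ψᵀ. -/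
open Matrix Set

/-- For `Ψ = [[a,b],[c,d]]` with `det Ψ = 1`, one has
`(a+d)² + (b-c)² = a² + b² + c² + d² + 2 > 0`, and the unique positive-definite
symmetric square root `S` of `ΨΨᵀ` satisfies
`S⁻¹Ψ = (1/√((a+d)²+(b-c)²))·[[a+d, b-c],[-(b-c), a+d]]`. -/
theorem statement2 (a b c d : ℝ) (h : (!![a, b; c, d] : M2).det = 1) :
    ((a + d)^2 + (b - c)^2 = a^2 + b^2 + c^2 + d^2 + 2 ∧
      0 < (a + d)^2 + (b - c)^2) ∧
    (∀ S : M2, S.PosDef → S * S = !![a, b; c, d] * (!![a, b; c, d] : M2)ᵀ →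
      S⁻¹ * !![a, b; c, d]
        = (1 / Real.sqrt ((a + d)^2 + (b - c)^2)) •
            !![a + d, b - c; -(b - c), a + d]) := by
  have hdet : a * d - b * c = 1 := by simpa [Matrix.det_fin_two] using h
  have hsum : (a + d)^2 + (b - c)^2 = a^2 + b^2 + c^2 + d^2 + 2 := by
    linear_combination 2 * hdet
  have hpos : 0 < (a + d)^2 + (b - c)^2 := by rw [hsum]; positivity
  refine ⟨⟨hsum, hpos⟩, fun S hS hSS => ?_⟩
  have hsymm : S 1 0 = S 0 1 := by simpa using hS.isHermitian.apply 0 1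
  have hdS : 0 < S.det := hS.det_pos
  have htr : 0 < S.trace := hS.trace_pos
  have hdS1 : S.det = 1 := by
    have hsq : S.det * S.det = 1 := by
      rw [← Matrix.det_mul, hSS, Matrix.det_mul, Matrix.det_transpose, h, one_mul]
    nlinarith
  have e00 := congrFun (congrFun hSS 0) 0
  have e01 := congrFun (congrFun hSS 0) 1
  have e11 := congrFun (congrFun hSS 1) 1
  have hdetS := hdS1
  simp [Matrix.mul_apply, Fin.sum_univ_two, hsymm] at e00 e01 e11
  rw [Matrix.det_fin_two, hsymm] at hdetS
  rw [Matrix.trace_fin_two] at htr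
  have hsqrt : Real.sqrt ((a + d)^2 + (b - c)^2) = S 0 0 + S 1 1 := by
    rw [Real.sqrt_eq_iff_mul_self_eq hpos.le htr.le]
    linear_combination 2 * hdet - e00 - e11 - 2 * hdetS
  have hinv : S⁻¹ = S.adjugate := by simp [Matrix.inv_def, hdS1]
  have h00 : (S 0 0 + S 1 1) * S 0 0 = a^2 + b^2 + 1 := by
    linear_combination e00 + hdetS
  have h01 : (S 0 0 + S 1 1) * S 0 1 = a * c + b * d := by
    linear_combination e01
  have h11 : (S 0 0 + S 1 1) * S 1 1 = c^2 + d^2 + 1 := by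
    linear_combination e11 + hdetS
  rw [hsqrt, hinv, Matrix.adjugate_fin_two, hsymm, one_div, eq_inv_smul_iff₀ htr.ne']
  ext i j
  fin_cases i <;> fin_cases j <;>
    simp
  · linear_combination a * h11 - c * h01 + d * hdet
  · linear_combination b * h11 - d * h01 - c * hdet
  · linear_combination c * h00 - a * h01 - b * hdet
  · linear_combination d * h00 - b * h01 + a * hdet
end

section
/- Let Ψ ∈ SL(2,ℝ). If ρ(Ψ) = I and Ψ ≠ I, then tr(Ψ) > 2; if ρ(Ψ) = −I, then tr(Ψ) ≤ −2. In other words, the fiber ρ^{−1}(I) with the identity removed is contained in {ψ ∈ SL(2,ℝ) : tr ψ > 2}, and the fiber ρ^{−1}(−I) is contained in {ψ ∈ SL(2,ℝ) : tr ψ < 2}. -/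
open Matrix Set

/-- If `ρ(Ψ)` is the nonzero scalar matrix `s`, then `Ψ` is symmetric and its trace has the
sign of `s`. -/
theorem symm_and_trace_pos_of_rho_eq_smul_one {Ψ : M2} {s : ℝ} (hs : s ≠ 0)
    (h : rho Ψ = s • (1 : M2)) : Ψ 0 1 = Ψ 1 0 ∧ 0 < s * Ψ.trace := by
  have diag := congrFun (congrFun h 0) 0
  have off := congrFun (congrFun h 0) 1
  simp only [rho, Matrix.smul_apply, Matrix.of_apply, Matrix.cons_val', Matrix.cons_val_zero,
    Matrix.cons_val_one, Matrix.cons_val_fin_one, Matrix.one_apply_eq, smul_eq_mul, mul_one,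
    Matrix.one_apply_ne zero_ne_one, mul_zero] at diag off
  set k := 1 / √((Ψ 0 0 + Ψ 1 1) ^ 2 + (Ψ 0 1 - Ψ 1 0) ^ 2)
  have hk0 : k ≠ 0 := fun hk => hs (by rw [← diag, hk, zero_mul])
  have hk : 0 < k := lt_of_le_of_ne (by positivity) hk0.symm
  have htr : Ψ 0 0 + Ψ 1 1 ≠ 0 := fun ht => hs (by rw [← diag, ht, mul_zero])
  refine ⟨sub_eq_zero.mp ((mul_eq_zero.mp off).resolve_left hk0), ?_⟩
  rw [Matrix.trace_fin_two, ← diag, mul_assoc]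
  exact mul_pos hk (mul_self_pos.mpr htr)

/-- The squared trace of a symmetric 2×2 matrix of determinant one. -/
theorem trace_sq_of_symm_of_det_eq_one {Ψ : M2} (hdet : Ψ.det = 1) (hsymm : Ψ 0 1 = Ψ 1 0) :
    Ψ.trace ^ 2 = 4 + (Ψ 0 0 - Ψ 1 1) ^ 2 + 4 * Ψ 1 0 ^ 2 := by
  rw [Matrix.det_fin_two, hsymm] at hdet
  rw [Matrix.trace_fin_two]
  linear_combination 4 * hdet

/-- For `Ψ ∈ SL(2,ℝ)`: if `ρ(Ψ) = I` and `Ψ ≠ I` then `tr Ψ > 2`;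
if `ρ(Ψ) = -I` then `tr Ψ ≤ -2`; in particular `ρ⁻¹(I) ∖ {I} ⊆ {tr > 2}` and
`ρ⁻¹(-I) ⊆ {tr < 2}`. -/
theorem statement3 (Ψ : M2) (h : Ψ.det = 1) :
    (rho Ψ = 1 → Ψ ≠ 1 → 2 < Ψ.trace) ∧
    (rho Ψ = -1 → Ψ.trace ≤ -2) ∧
    (rho Ψ = -1 → Ψ.trace < 2) := by
  have hneg : rho Ψ = -1 → Ψ.trace ≤ -2 := by
    intro hρ
    obtain ⟨hsymm, hpos⟩ := symm_and_trace_pos_of_rho_eq_smul_one (s := -1) (by norm_num)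
      (by rw [hρ, neg_one_smul])
    have hsq := trace_sq_of_symm_of_det_eq_one h hsymm
    nlinarith [sq_nonneg (Ψ 0 0 - Ψ 1 1), sq_nonneg (Ψ 1 0)]
  refine ⟨fun hρ hne => ?_, hneg, fun hρ => (hneg hρ).trans_lt (by norm_num)⟩
  obtain ⟨hsymm, hpos⟩ := symm_and_trace_pos_of_rho_eq_smul_one (s := 1) one_ne_zero
    (by rw [hρ, one_smul])
  have hsq := trace_sq_of_symm_of_det_eq_one h hsymm
  by_contra! hle
  have hsq_le : Ψ.trace ^ 2 ≤ 4 := by nlinarith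
  have hdiag : Ψ 0 0 - Ψ 1 1 = 0 :=
    pow_eq_zero_iff two_ne_zero |>.mp
      (le_antisymm (by nlinarith [sq_nonneg (Ψ 1 0)]) (sq_nonneg _))
  have hoff : Ψ 1 0 = 0 :=
    pow_eq_zero_iff two_ne_zero |>.mp
      (le_antisymm (by nlinarith [sq_nonneg (Ψ 0 0 - Ψ 1 1)]) (sq_nonneg _))
  rw [hdiag, hoff] at hsq
  have htr : Ψ.trace = 2 := by nlinarith
  rw [Matrix.trace_fin_two] at htr
  apply hne
  ext i j
  fin_cases i <;> fin_cases j <;> simp <;> linarith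
end

section
/- Let ψ : [0,T] → SL(2,ℝ) be a continuous path with ψ(0) = I and det(ψ(T) − I) ≠ 0, and let θ : [0,T] → ℝ be the unique continuous function with θ(0) = 0 such that ρ(ψ(t)) is the rotation by angle θ(t). Let ψ̃ : [0,2T] → SL(2,ℝ) be any continuous extension of ψ with det(ψ̃(t) − I) ≠ 0 for all t ∈ [T,2T] and ψ̃(2T) ∈ {−I, diag(2,1/2)}. Then the loop t ↦ ρ(ψ̃(t))² in SO(2) (it is a loop since ρ(ψ̃(0))² = ρ(ψ̃(2T))² = I) has winding number equal to the even integer closest to θ(T)/π if tr ψ(T) > 2, and equal to the odd integer closest to θ(T)/π if tr ψ(T) < 2 (in each case this closest integer is well defined). In particular the winding number is independent of the choice of extension ψ̃. -/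
open Matrix Set

theorem det_sub_one_fin_two (A : M2) : (A - 1).det = A.det - A.trace + 1 := by
  simp only [det_fin_two, trace_fin_two, Matrix.sub_apply, one_fin_two, of_apply,
    cons_val', cons_val_zero, cons_val_one, cons_val_fin_one]
  ring

theorem trace_div_sqrt_eq_cos {A : M2} {x : ℝ} (h : rho A = rotMat x) :
    A.trace / Real.sqrt (A.trace ^ 2 + (A 0 1 - A 1 0) ^ 2) = Real.cos x := by
  have h00 := congrFun (congrFun h 0) 0
  simp only [rho, rotMat, Matrix.smul_apply, of_apply, cons_val', cons_val_zero, cons_val_fin_one,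
    smul_eq_mul] at h00
  rw [trace_fin_two, ← h00]
  ring

/-- A matrix of determinant one whose polar rotation is trivial is symmetric with positive trace,
so its trace is at least two. -/
theorem two_le_trace_of_cos_eq_one {A : M2} {x : ℝ} (hA : A.det = 1) (h : rho A = rotMat x)
    (hx : Real.cos x = 1) : 2 ≤ A.trace := by
  have hc := trace_div_sqrt_eq_cos h
  rw [hx] at hc
  set r := Real.sqrt (A.trace ^ 2 + (A 0 1 - A 1 0) ^ 2) with hr
  have hr0 : r ≠ 0 := by
    intro h0
    simp [h0] at hc
  have htr : A.trace = r := by rwa [div_eq_one_iff_eq hr0] at hc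
  have hsq : r ^ 2 = A.trace ^ 2 + (A 0 1 - A 1 0) ^ 2 := Real.sq_sqrt (by positivity)
  have hsymm : A 0 1 = A 1 0 := by
    rw [htr] at hsq
    nlinarith
  have hpos : 0 ≤ A.trace := htr ▸ Real.sqrt_nonneg _
  rw [det_fin_two, hsymm] at hA
  rw [trace_fin_two] at hpos ⊢
  nlinarith [sq_nonneg (A 0 0 - A 1 1), sq_nonneg (A 1 0)]

/-- A continuous angle which never becomes antipodal to its final value
moves by less than half a turn. -/
theorem abs_sub_lt_pi_of_cos_ne {f : ℝ → ℝ} {a b : ℝ} (hab : a ≤ b)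
    (hf : ContinuousOn f (Icc a b)) (hne : ∀ t ∈ Icc a b, Real.cos (f t) ≠ -Real.cos (f b)) :
    |f a - f b| < Real.pi := by
  rw [abs_sub_lt_iff]
  constructor <;> by_contra! hle
  · obtain ⟨t, ht, hft⟩ := intermediate_value_Icc' hab hf
      (show f b + Real.pi ∈ Icc (f b) (f a) from ⟨by linarith [Real.pi_pos], by linarith⟩)
    exact hne t ht (by rw [hft, Real.cos_add_pi])
  · obtain ⟨t, ht, hft⟩ := intermediate_value_Icc hab hf
      (show f b - Real.pi ∈ Icc (f a) (f b) from ⟨by linarith, by linarith [Real.pi_pos]⟩)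
    exact hne t ht (by rw [hft, Real.cos_sub_pi])

theorem abs_div_pi_sub_lt_one {x y k : ℝ} (h : |x - y| < Real.pi) (hy : y = k * Real.pi) :
    |x / Real.pi - k| < 1 := by
  have hπ := Real.pi_pos
  rw [show x / Real.pi - k = (x - y) / Real.pi by rw [hy]; field_simp, abs_div, abs_of_pos hπ,
    div_lt_one hπ]
  exact h

/-- Let `ψ : [0,T] → SL(2,ℝ)` with `ψ(0) = I` and `det(ψ(T) - I) ≠ 0`, let
`θ` be the continuous angle lift of `t ↦ ρ(ψ̃(t))` with `θ(0) = 0`, and let `ψ̃` be any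
continuous extension of `ψ` to `[0,2T]` avoiding the Maslov cycle on `[T,2T]` with
`ψ̃(2T) ∈ {-I, diag(2,1/2)}`.  Then the winding number of the loop `t ↦ ρ(ψ̃(t))²`,
i.e. the integer `k` with `θ(2T) = kπ`, is the even integer closest to `θ(T)/π` if
`tr ψ(T) > 2`, and the odd integer closest to `θ(T)/π` if `tr ψ(T) < 2`; in particular
it does not depend on the choice of extension. -/
theorem statement4 (T : ℝ) (hT : 0 < T)
    (ψ ψext : ℝ → M2)
    (hψ0 : ψ 0 = 1)
    (hagree : ∀ t ∈ Set.Icc (0:ℝ) T, ψext t = ψ t)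
    (hcont : ContinuousOn ψext (Set.Icc 0 (2*T)))
    (hsl : ∀ t ∈ Set.Icc (0:ℝ) (2*T), (ψext t).det = 1)
    (hnd : (ψ T - 1).det ≠ 0)
    (hndext : ∀ t ∈ Set.Icc T (2*T), (ψext t - 1).det ≠ 0)
    (hend : ψext (2*T) = -1 ∨ ψext (2*T) = !![2, 0; 0, 1/2])
    (θ : ℝ → ℝ) (hθc : ContinuousOn θ (Set.Icc 0 (2*T))) (hθ0 : θ 0 = 0)
    (hθ : ∀ t ∈ Set.Icc (0:ℝ) (2*T), rho (ψext t) = rotMat (θ t)) :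
    ((2:ℝ) < (ψ T).trace →
      ∃ k : ℤ, Even k ∧ θ (2*T) = k * Real.pi ∧ |θ T / Real.pi - (k:ℝ)| < 1) ∧
    ((ψ T).trace < 2 →
      ∃ k : ℤ, Odd k ∧ θ (2*T) = k * Real.pi ∧ |θ T / Real.pi - (k:ℝ)| < 1) := by
  have hTT : T ≤ 2 * T := by linarith
  have hsub : Icc T (2 * T) ⊆ Icc 0 (2 * T) := Icc_subset_Icc_left hT.le
  have hTmem : T ∈ Icc T (2 * T) := left_mem_Icc.2 hTT
  have h2T : 2 * T ∈ Icc T (2 * T) := right_mem_Icc.2 hTT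
  have hθ2T := trace_div_sqrt_eq_cos (hθ _ (hsub h2T))
  have hψT : ψ T = ψext T := (hagree T ⟨hT.le, le_rfl⟩).symm
  have htrc : ContinuousOn (fun t => (ψext t).trace) (Icc T (2 * T)) :=
    (continuous_id.matrix_trace).comp_continuousOn (hcont.mono hsub)
  have htr_ne : ∀ t ∈ Icc T (2 * T), (ψext t).trace ≠ 2 := by
    intro t ht h2
    apply hndext t ht
    rw [det_sub_one_fin_two, hsl t (hsub ht), h2]
    norm_num
  rw [hψT]
  constructor
  · intro hgt
    have htr : ∀ t ∈ Icc T (2 * T), 2 < (ψext t).trace := by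
      intro t ht
      by_contra! hle
      obtain ⟨s, hs, hs2⟩ := intermediate_value_Icc' ht.1
        (htrc.mono (Icc_subset_Icc_right ht.2)) ⟨hle, hgt.le⟩
      exact htr_ne s ⟨hs.1, hs.2.trans ht.2⟩ hs2
    have hcos : Real.cos (θ (2 * T)) = 1 := by
      rcases hend with h | h
      · have := htr _ h2T
        rw [h, trace_fin_two] at this
        norm_num at this
      · rw [← hθ2T, h]
        have hr : Real.sqrt ((5 / 2 : ℝ) ^ 2) = 5 / 2 := Real.sqrt_sq (by norm_num)
        norm_num [trace_fin_two] at hr ⊢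
    have hlt := abs_sub_lt_pi_of_cos_ne hTT (hθc.mono hsub) fun t ht hc => by
      rw [hcos, ← trace_div_sqrt_eq_cos (hθ t (hsub ht))] at hc
      have : 0 ≤ (ψext t).trace / Real.sqrt ((ψext t).trace ^ 2 +
          (ψext t 0 1 - ψext t 1 0) ^ 2) :=
        div_nonneg (by linarith [htr t ht]) (Real.sqrt_nonneg _)
      linarith
    obtain ⟨m, hm⟩ := (Real.cos_eq_one_iff _).1 hcos
    have hk : θ (2 * T) = ((2 * m : ℤ) : ℝ) * Real.pi := by
      rw [← hm]
      push_cast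
      ring
    exact ⟨2 * m, even_two_mul m, hk, abs_div_pi_sub_lt_one hlt hk⟩
  · intro hlt2
    have htr : ∀ t ∈ Icc T (2 * T), (ψext t).trace < 2 := by
      intro t ht
      by_contra! hle
      obtain ⟨s, hs, hs2⟩ := intermediate_value_Icc ht.1
        (htrc.mono (Icc_subset_Icc_right ht.2)) ⟨hlt2.le, hle⟩
      exact htr_ne s ⟨hs.1, hs.2.trans ht.2⟩ hs2
    have hcos : Real.cos (θ (2 * T)) = -1 := by
      rcases hend with h | h
      · rw [← hθ2T, h]
        have hr : Real.sqrt ((2 : ℝ) ^ 2) = 2 := Real.sqrt_sq (by norm_num)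
        norm_num [trace_fin_two] at hr ⊢
      · have := htr _ h2T
        rw [h, trace_fin_two] at this
        norm_num at this
    have hlt := abs_sub_lt_pi_of_cos_ne hTT (hθc.mono hsub) fun t ht hc => by
      rw [hcos, neg_neg] at hc
      have := two_le_trace_of_cos_eq_one (hsl t (hsub ht)) (hθ t (hsub ht)) hc
      linarith [htr t ht]
    obtain ⟨m, hm⟩ := Real.cos_eq_neg_one_iff.1 hcos
    have hk : θ (2 * T) = ((2 * m + 1 : ℤ) : ℝ) * Real.pi := by
      rw [← hm]
      push_cast
      ring
    exact ⟨2 * m + 1, odd_two_mul_add_one m, hk, abs_div_pi_sub_lt_one hlt hk⟩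
end

section
/- For every μ ∈ [0, 0.5] and every c ∈ [2.1, 2.1 + 10⁻⁶], the hypersurface Σ_{μ,c} is the boundary of a compact convex subset of ℝ⁴ ≅ ℂ² with nonempty interior. -/
open Matrix Set

/-- Dense univariate polynomials, lowest coefficient first. -/
structure DensePoly (R : Type) where
  coeffs : List R

namespace DensePoly

variable {R : Type}

/-- Sum of coefficient lists. -/
def addAux [Add R] : List R → List R → List R
  | [], q => q
  | a :: p, [] => a :: p
  | a :: p, b :: q => (a + b) :: addAux p q

/-- Product of coefficient lists. -/
def mulAux [Zero R] [Add R] [Mul R] : List R → List R → List R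
  | [], _ => []
  | a :: p, q => addAux (q.map (a * ·)) (0 :: mulAux p q)

instance : Zero (DensePoly R) := ⟨⟨[]⟩⟩
instance [Add R] : Add (DensePoly R) := ⟨fun p q => ⟨addAux p.coeffs q.coeffs⟩⟩
instance [Zero R] [Add R] [Mul R] : Mul (DensePoly R) := ⟨fun p q => ⟨mulAux p.coeffs q.coeffs⟩⟩

/-- The constant polynomial. -/
def C (a : R) : DensePoly R := ⟨[a]⟩

/-- Horner evaluation of a coefficient list. -/
def evalAux (φ : R → ℝ) (x : ℝ) : List R → ℝ
  | [] => 0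
  | a :: p => φ a + x * evalAux φ x p

/-- Evaluation at `x`, the coefficients being sent to `ℝ` by `φ`. -/
def eval (φ : R → ℝ) (x : ℝ) (p : DensePoly R) : ℝ := evalAux φ x p.coeffs

/-- `φ` respects `0`, `+` and `*`. -/
structure Respects [Zero R] [Add R] [Mul R] (φ : R → ℝ) : Prop where
  zero : φ 0 = 0
  add : ∀ a b, φ (a + b) = φ a + φ b
  mul : ∀ a b, φ (a * b) = φ a * φ b

section eval

variable [Zero R] [Add R] [Mul R] {φ : R → ℝ}

theorem evalAux_addAux (hφ : Respects φ) (x : ℝ) (p q : List R) :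
    evalAux φ x (addAux p q) = evalAux φ x p + evalAux φ x q := by
  induction p, q using addAux.induct <;> simp_all [addAux, evalAux, hφ.add]
  ring

theorem evalAux_map (hφ : Respects φ) (x : ℝ) (a : R) (p : List R) :
    evalAux φ x (p.map (a * ·)) = φ a * evalAux φ x p := by
  induction p <;> simp_all [evalAux, hφ.mul]
  ring

theorem evalAux_mulAux (hφ : Respects φ) (x : ℝ) (p q : List R) :
    evalAux φ x (mulAux p q) = evalAux φ x p * evalAux φ x q := by
  induction p <;> simp_all [mulAux, evalAux, evalAux_addAux hφ, evalAux_map hφ, hφ.zero]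
  ring

theorem respects_eval (hφ : Respects φ) (x : ℝ) : Respects (eval φ x) where
  zero := rfl
  add p q := evalAux_addAux hφ x p.coeffs q.coeffs
  mul p q := evalAux_mulAux hφ x p.coeffs q.coeffs

end eval

theorem eval_C (φ : R → ℝ) (x : ℝ) (a : R) : eval φ x (C a) = φ a := by
  simp [eval, evalAux, C]

/-- `B ^ n * p`. -/
def mulPow [Zero R] [Add R] [Mul R] (B p : DensePoly R) : ℕ → DensePoly R
  | 0 => p
  | n + 1 => B * mulPow B p n

/-- `B ^ n * p (A / B)` for a polynomial `p` with `n + 1` coefficients. -/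
def homogenize [Zero R] [Add R] [Mul R] (A B : DensePoly R) : List R → DensePoly R
  | [] => 0
  | c :: cs => mulPow B (C c) cs.length + A * homogenize A B cs

theorem eval_mulPow [Zero R] [Add R] [Mul R] {φ : R → ℝ} (hφ : Respects φ) (x : ℝ)
    (B p : DensePoly R) (n : ℕ) :
    eval φ x (mulPow B p n) = eval φ x B ^ n * eval φ x p := by
  induction n with
  | zero => simp [mulPow]
  | succ n ih => rw [mulPow, (respects_eval hφ x).mul, ih]; ring

theorem eval_homogenize [Zero R] [Add R] [Mul R] {φ : R → ℝ} (hφ : Respects φ) {x y : ℝ}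
    {A B : DensePoly R} (h : eval φ x A = eval φ x B * y) (l : List R) :
    eval φ x (homogenize A B l) * eval φ x B = eval φ x B ^ l.length * evalAux φ y l := by
  induction l with
  | nil => simp [homogenize, evalAux, (respects_eval hφ x).zero]
  | cons c cs ih =>
    rw [homogenize, (respects_eval hφ x).add, (respects_eval hφ x).mul, eval_mulPow hφ, eval_C, h,
      evalAux, List.length_cons, pow_succ]
    linear_combination eval φ x B * y * ih

theorem eval_nonneg {φ : R → ℝ} {x : ℝ} (hx : 0 ≤ x) {p : DensePoly R}
    (h : ∀ c ∈ p.coeffs, 0 ≤ φ c) : 0 ≤ eval φ x p := by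
  obtain ⟨l⟩ := p
  induction l with
  | nil => simp [eval, evalAux]
  | cons c cs ih =>
    have h1 : 0 ≤ φ c := h c (by simp)
    have h2 : 0 ≤ evalAux φ x cs := ih fun d hd => h d (by simp at hd ⊢; exact Or.inr hd)
    simp only [eval, evalAux]
    positivity

/-- The coefficients of `(D (1 + u)) ^ n * p ((a + b u) / (D (1 + u)))`, with integers embedded
in `R` by `ι`; up to scaling these are the Bernstein coefficients of `p` on `[a / D, b / D]`. -/
def bernstein [Zero R] [Add R] [Mul R] (ι : ℤ → R) (D a b : ℤ) (p : DensePoly R) : List R :=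
  (homogenize ⟨[ι a, ι b]⟩ ⟨[ι D, ι D]⟩ p.coeffs).coeffs

theorem eval_nonneg_of_bernstein [Zero R] [Add R] [Mul R] {φ : R → ℝ} (hφ : Respects φ)
    {ι : ℤ → R} (hι : ∀ n, φ (ι n) = n) {D a b : ℤ} (hD : 0 < D) {p : DensePoly R} {x : ℝ}
    (ha : (a : ℝ) ≤ D * x) (hb : D * x < b) (h : ∀ c ∈ bernstein ι D a b p, 0 ≤ φ c) :
    0 ≤ eval φ x p := by
  have hD' : (0 : ℝ) < D := by exact_mod_cast hD
  have hb' : 0 < b - D * x := by linarith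
  set u : ℝ := (D * x - a) / (b - D * x) with hu
  have hu0 : 0 ≤ u := div_nonneg (by linarith) hb'.le
  have huq : u * (b - D * x) = D * x - a := by rw [hu]; field_simp
  have hB : eval φ u (⟨[ι D, ι D]⟩ : DensePoly R) = D * (1 + u) := by
    simp [eval, evalAux, hι]; ring
  have hA : eval φ u (⟨[ι a, ι b]⟩ : DensePoly R) = D * (1 + u) * x := by
    simp [eval, evalAux, hι]; linear_combination huq
  have h1 := eval_homogenize hφ (A := ⟨[ι a, ι b]⟩) (B := ⟨[ι D, ι D]⟩) (y := x)
    (by rw [hA, hB]) p.coeffs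
  have h2 : 0 ≤ eval φ u (homogenize ⟨[ι a, ι b]⟩ ⟨[ι D, ι D]⟩ p.coeffs) := eval_nonneg hu0 h
  have h3 : 0 < eval φ u (⟨[ι D, ι D]⟩ : DensePoly R) := by rw [hB]; positivity
  have h4 : 0 ≤ eval φ u (⟨[ι D, ι D]⟩ : DensePoly R) ^ p.coeffs.length * evalAux φ x p.coeffs := by
    rw [← h1]; positivity
  exact nonneg_of_mul_nonneg_right h4 (by positivity)

theorem respects_intCast : Respects (fun n : ℤ => (n : ℝ)) where
  zero := by simp
  add := by simp
  mul := by simp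

/-- Evaluation at `(x, y)`, where `x` is the outer variable. -/
def eval₂ (x y : ℝ) (p : DensePoly (DensePoly ℤ)) : ℝ :=
  eval (eval (fun n : ℤ => (n : ℝ)) y) x p

/-- Nonnegativity of all tensor Bernstein coefficients on `[a / D, b / D] × [a' / D, b' / D]`. -/
def boxCheck (D a b a' b' : ℤ) (p : DensePoly (DensePoly ℤ)) : Bool :=
  (bernstein C D a b p).all fun c => (bernstein id D a' b' c).all fun n => decide (0 ≤ n)

theorem eval₂_nonneg_of_boxCheck {D a b a' b' : ℤ} (hD : 0 < D) {p : DensePoly (DensePoly ℤ)}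
    (h : boxCheck D a b a' b' p = true) {x y : ℝ} (ha : (a : ℝ) ≤ D * x) (hb : D * x < b)
    (ha' : (a' : ℝ) ≤ D * y) (hb' : D * y < b') : 0 ≤ eval₂ x y p := by
  simp only [boxCheck, List.all_eq_true, decide_eq_true_eq] at h
  refine eval_nonneg_of_bernstein (respects_eval respects_intCast y) (fun n => eval_C _ _ _) hD
    ha hb fun c hc => ?_
  refine eval_nonneg_of_bernstein respects_intCast (ι := id) (fun n => rfl) hD ha' hb'
    fun n hn => ?_
  exact_mod_cast h c hc n hn

end DensePoly

section certificates

variable {R : Type} [Add R] [Mul R]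

/-- `2 (1 - 2 Re z²)` in terms of `s = |z|²` and `N = |1 - 2 z²|`. -/
def polyW (k : ℤ → R) (s N : R) : R := k 1 + N * N + k (-4) * (s * s)

/-- `3000` times an upper bound for the kinetic energy `|w + a(z)|²` on `|z|² = s`,
with `M = 2 μ` and `Q / 12000` an upper bound for `1 / (1 - 2 s)`. -/
def polyP (k : ℤ → R) (s M Q : R) : R :=
  k 3021 + k (-1500) * M + k (-150) * (k 84 + k (-5) * (M * M) + k (-20) * M) * s
    + k 12000 * (s * s * s) + M * (s * s * s) * Q

/-- `3000 N⁵` times the radial coefficient of the convexity form. -/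
def polyA (k : ℤ → R) (s N M Q : R) : R :=
  (k (-720000) * (s * s) + k 600 * (k 84 + k (-5) * (M * M) + k (-20) * M)
    + k (-36000000) * (s * s * s * s)
    + k 150000 * (k 84 + k (-5) * (M * M) + k (-20) * M) * (s * s)
    + (k (-62500) * (s * s * s) + k (-16)) * polyP k s M Q + k (-108000) * s) * (N * N * N * N * N)
  + k (-6000) * M * (k 3 * (polyW k s N * polyW k s N)
      + (k (-4) + k (-3) * polyW k s N) * (N * N)
      + (k (-14) + k 6 * polyW k s N) * (N * N * N * N * N))
  + k (-1500000) * s * M * (s * polyW k s N * (N * N)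
      + (k (-6) * s + k 2 * s * polyW k s N) * (N * N * N * N * N))

/-- `3000 N⁵` times the angular coefficient of the convexity form. -/
def polyD (k : ℤ → R) (s N M Q : R) : R :=
  (k (-144000) * (s * s) + k 600 * (k 84 + k (-5) * (M * M) + k (-20) * M)
    + k (-16) * polyP k s M Q + k (-12000) * s) * (N * N * N * N * N)
  + k (-6000) * M * ((k 8 + k 3 * polyW k s N) * (N * N)
      + k (-3) * (polyW k s N * polyW k s N) + k (-2) * (N * N * N * N * N))

/-- `N⁵` times the main factor of the mixed coefficient of the convexity form. -/
def polyY (k : ℤ → R) (s N : R) : R :=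
  k 12 + k (-48) * (s * s) + k (-12) * (N * N * N * N * N)
    + k 500 * (s * s) * (N * N + k (-1) * (N * N * N * N * N))

/-- `9000000 N¹⁰` times the determinant of the convexity form. -/
def polyF (k : ℤ → R) (s N M Q : R) : R :=
  polyA k s N M Q * polyD k s N M Q
    + k (-2250000) * (M * M) * (k 4 * (N * N) + k (-1) * (polyW k s N * polyW k s N))
      * (polyY k s N * polyY k s N)

/-- `200⁴` times `polyP` at `s = S / 200` and `Q = 3632 + 81840 s`. -/
def polyBdry (k : ℤ → R) (M S : R) : R :=
  k 1600000000 * (k 3021 + k (-1500) * M)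
    + k (-1200000000) * (k 84 + k (-5) * (M * M) + k (-20) * M) * S
    + k 2400000 * (S * S * S) + M * (S * S * S) * (k 726400 + k 81840 * S)

end certificates

namespace DensePoly

/-- Integer constants as bivariate polynomials. -/
def cst (n : ℤ) : DensePoly (DensePoly ℤ) := C (C n)

/-- The outer variable. -/
def varX : DensePoly (DensePoly ℤ) := ⟨[0, C 1]⟩

/-- The inner variable. -/
def varY : DensePoly (DensePoly ℤ) := C ⟨[0, 1]⟩

theorem eval₂_add (x y : ℝ) (p q : DensePoly (DensePoly ℤ)) :
    eval₂ x y (p + q) = eval₂ x y p + eval₂ x y q :=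
  (respects_eval (respects_eval respects_intCast y) x).add p q

theorem eval₂_mul (x y : ℝ) (p q : DensePoly (DensePoly ℤ)) :
    eval₂ x y (p * q) = eval₂ x y p * eval₂ x y q :=
  (respects_eval (respects_eval respects_intCast y) x).mul p q

theorem eval₂_cst (x y : ℝ) (n : ℤ) : eval₂ x y (cst n) = n := by
  simp [eval₂, cst, eval_C]

theorem eval₂_varX (x y : ℝ) : eval₂ x y varX = x := by
  simp [eval₂, varX, eval, evalAux, C]

theorem eval₂_varY (x y : ℝ) : eval₂ x y varY = y := by
  simp [eval₂, varY, eval, evalAux, C]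

theorem eval₂_polyD (x y : ℝ) (s N M Q : DensePoly (DensePoly ℤ)) :
    eval₂ x y (polyD cst s N M Q) =
      polyD (fun n : ℤ => (n : ℝ)) (eval₂ x y s) (eval₂ x y N) (eval₂ x y M) (eval₂ x y Q) := by
  simp only [polyD, polyP, polyW, eval₂_add, eval₂_mul, eval₂_cst]

theorem eval₂_polyF (x y : ℝ) (s N M Q : DensePoly (DensePoly ℤ)) :
    eval₂ x y (polyF cst s N M Q) =
      polyF (fun n : ℤ => (n : ℝ)) (eval₂ x y s) (eval₂ x y N) (eval₂ x y M) (eval₂ x y Q) := by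
  simp only [polyF, polyA, polyD, polyP, polyW, polyY, eval₂_add, eval₂_mul, eval₂_cst]

theorem eval₂_polyBdry (x y : ℝ) (M S : DensePoly (DensePoly ℤ)) :
    eval₂ x y (polyBdry cst M S) =
      polyBdry (fun n : ℤ => (n : ℝ)) (eval₂ x y M) (eval₂ x y S) := by
  simp only [polyBdry, eval₂_add, eval₂_mul, eval₂_cst]

theorem boxCheck_polyF_inner_low :
    boxCheck 10 0 1 8 12 (polyF cst varX varY (cst 1) (cst 12000 + cst 40000 * varX)) = true := by
  decide +kernel

theorem boxCheck_polyF_inner_high :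
    boxCheck 10 1 2 6 14 (polyF cst varX varY (cst 1) (cst 12000 + cst 40000 * varX)) = true := by
  decide +kernel

theorem boxCheck_polyD_inner :
    boxCheck 10 0 2 6 14
      (polyD cst varX varY (cst 1) (cst 12000 + cst 40000 * varX)
        + cst (-1) * (varY * varY * varY * varY * varY)) = true := by
  decide +kernel

theorem boxCheck_polyF_outer_low :
    boxCheck 1000 200 256 488 744
      (polyF cst varX varY (cst 3 + cst (-10) * varX) (cst 3632 + cst 81840 * varX)) = true := by
  decide +kernel

theorem boxCheck_polyF_outer_mid :
    boxCheck 1000 200 256 744 1000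
      (polyF cst varX varY (cst 3 + cst (-10) * varX) (cst 3632 + cst 81840 * varX)) = true := by
  decide +kernel

theorem boxCheck_polyF_outer_high :
    boxCheck 1000 200 256 1000 1512
      (polyF cst varX varY (cst 3 + cst (-10) * varX) (cst 3632 + cst 81840 * varX)) = true := by
  decide +kernel

theorem boxCheck_polyD_outer_low :
    boxCheck 1000 200 256 488 1000
      (polyD cst varX varY (cst 3 + cst (-10) * varX) (cst 3632 + cst 81840 * varX)
        + cst (-1) * (varY * varY * varY * varY * varY)) = true := by
  decide +kernel

theorem boxCheck_polyD_outer_high :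
    boxCheck 1000 200 256 1000 1512
      (polyD cst varX varY (cst 3 + cst (-10) * varX) (cst 3632 + cst 81840 * varX)
        + cst (-1) * (varY * varY * varY * varY * varY)) = true := by
  decide +kernel

theorem boxCheck_polyF_zero_low :
    boxCheck 1000 0 128 488 1512 (polyF cst varX varY (cst 0) (cst 0)) = true := by
  decide +kernel

theorem boxCheck_polyF_zero_high :
    boxCheck 1000 128 256 488 1512 (polyF cst varX varY (cst 0) (cst 0)) = true := by
  decide +kernel

theorem boxCheck_polyD_zero :
    boxCheck 1000 0 256 488 1512
      (polyD cst varX varY (cst 0) (cst 0)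
        + cst (-1) * (varY * varY * varY * varY * varY)) = true := by
  decide +kernel

theorem boxCheck_polyBdry_pos_low :
    boxCheck 1000 0 250 0 1000
      (polyBdry cst varX (cst 51 + cst (-5) * varX + cst (-6) * (varX * varX)) + cst (-1)) =
        true := by
  decide +kernel

theorem boxCheck_polyBdry_pos_high :
    boxCheck 1000 250 1001 0 1000
      (polyBdry cst varX (cst 51 + cst (-5) * varX + cst (-6) * (varX * varX)) + cst (-1)) =
        true := by
  decide +kernel

theorem boxCheck_polyBdry_lt :
    boxCheck 1000 0 1001 0 1000
      (cst 33599999999 + cst (-1) *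
        polyBdry cst varX (cst 51 + cst (-5) * varX + cst (-6) * (varX * varX))) = true := by
  decide +kernel

end DensePoly

/-- Positivity of the convexity form with radial coefficient proportional to `polyA`, angular
coefficient proportional to `polyD` and determinant proportional to `polyF`. -/
def FormPos (s N M Q : ℝ) : Prop :=
  0 < polyD (fun n : ℤ => (n : ℝ)) s N M Q ∧ 0 ≤ polyF (fun n : ℤ => (n : ℝ)) s N M Q

section realBounds

open DensePoly

theorem formPos_inner {s N : ℝ} (hs0 : 0 ≤ s) (hs1 : s < 1 / 5) (hN0 : 1 - 2 * s ≤ N)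
    (hN1 : N ≤ 1 + 2 * s) : FormPos s N 1 (12000 + 40000 * s) := by
  constructor
  · have h := eval₂_nonneg_of_boxCheck (by norm_num) boxCheck_polyD_inner (x := s) (y := N)
      (by push_cast; linarith) (by push_cast; linarith) (by push_cast; linarith)
      (by push_cast; linarith)
    simp only [eval₂_polyD, eval₂_add, eval₂_mul, eval₂_cst, eval₂_varX, eval₂_varY] at h
    push_cast at h
    have hN : 0 < N * N * N * N * N := by
      have : 0 < N := by linarith
      positivity
    linarith
  · rcases lt_or_ge s (1 / 10) with hs | hs
    · have h := eval₂_nonneg_of_boxCheck (by norm_num) boxCheck_polyF_inner_low (x := s) (y := N)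
        (by push_cast; linarith) (by push_cast; linarith) (by push_cast; linarith)
        (by push_cast; linarith)
      simp only [eval₂_polyF, eval₂_add, eval₂_mul, eval₂_cst, eval₂_varX, eval₂_varY] at h
      push_cast at h
      exact h
    · have h := eval₂_nonneg_of_boxCheck (by norm_num) boxCheck_polyF_inner_high (x := s) (y := N)
        (by push_cast; linarith) (by push_cast; linarith) (by push_cast; linarith)
        (by push_cast; linarith)
      simp only [eval₂_polyF, eval₂_add, eval₂_mul, eval₂_cst, eval₂_varX, eval₂_varY] at h
      push_cast at h
      exact h

theorem formPos_outer {s N : ℝ} (hs0 : 1 / 5 ≤ s) (hs1 : s ≤ 51 / 200) (hN0 : 1 - 2 * s ≤ N)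
    (hN1 : N ≤ 1 + 2 * s) : FormPos s N (3 + -10 * s) (3632 + 81840 * s) := by
  constructor
  · have hN : 0 < N * N * N * N * N := by
      have : 0 < N := by linarith
      positivity
    rcases lt_or_ge N 1 with hN' | hN'
    · have h := eval₂_nonneg_of_boxCheck (by norm_num) boxCheck_polyD_outer_low (x := s) (y := N)
        (by push_cast; linarith) (by push_cast; linarith) (by push_cast; linarith)
        (by push_cast; linarith)
      simp only [eval₂_polyD, eval₂_add, eval₂_mul, eval₂_cst, eval₂_varX, eval₂_varY] at h
      push_cast at h
      linarith
    · have h := eval₂_nonneg_of_boxCheck (by norm_num) boxCheck_polyD_outer_high (x := s) (y := N)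
        (by push_cast; linarith) (by push_cast; linarith) (by push_cast; linarith)
        (by push_cast; linarith)
      simp only [eval₂_polyD, eval₂_add, eval₂_mul, eval₂_cst, eval₂_varX, eval₂_varY] at h
      push_cast at h
      linarith
  · rcases lt_or_ge N 1 with hN' | hN'
    · rcases lt_or_ge N (93 / 125) with hN'' | hN''
      · have h := eval₂_nonneg_of_boxCheck (by norm_num) boxCheck_polyF_outer_low (x := s) (y := N)
          (by push_cast; linarith) (by push_cast; linarith) (by push_cast; linarith)
          (by push_cast; linarith)
        simp only [eval₂_polyF, eval₂_add, eval₂_mul, eval₂_cst, eval₂_varX, eval₂_varY] at h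
        push_cast at h
        exact h
      · have h := eval₂_nonneg_of_boxCheck (by norm_num) boxCheck_polyF_outer_mid (x := s) (y := N)
          (by push_cast; linarith) (by push_cast; linarith) (by push_cast; linarith)
          (by push_cast; linarith)
        simp only [eval₂_polyF, eval₂_add, eval₂_mul, eval₂_cst, eval₂_varX, eval₂_varY] at h
        push_cast at h
        exact h
    · have h := eval₂_nonneg_of_boxCheck (by norm_num) boxCheck_polyF_outer_high (x := s) (y := N)
        (by push_cast; linarith) (by push_cast; linarith) (by push_cast; linarith)
        (by push_cast; linarith)
      simp only [eval₂_polyF, eval₂_add, eval₂_mul, eval₂_cst, eval₂_varX, eval₂_varY] at h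
      push_cast at h
      exact h

theorem formPos_zero {s N : ℝ} (hs0 : 0 ≤ s) (hs1 : s ≤ 51 / 200) (hN0 : 1 - 2 * s ≤ N)
    (hN1 : N ≤ 1 + 2 * s) (Q : ℝ) : FormPos s N 0 Q := by
  suffices FormPos s N 0 0 by
    simpa only [FormPos, polyF, polyA, polyD, polyP, zero_mul, mul_zero] using this
  constructor
  · have hN : 0 < N * N * N * N * N := by
      have : 0 < N := by linarith
      positivity
    have h := eval₂_nonneg_of_boxCheck (by norm_num) boxCheck_polyD_zero (x := s) (y := N)
      (by push_cast; linarith) (by push_cast; linarith) (by push_cast; linarith)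
      (by push_cast; linarith)
    simp only [eval₂_polyD, eval₂_add, eval₂_mul, eval₂_cst, eval₂_varX, eval₂_varY] at h
    push_cast at h
    linarith
  · rcases lt_or_ge s (16 / 125) with hs | hs
    · have h := eval₂_nonneg_of_boxCheck (by norm_num) boxCheck_polyF_zero_low (x := s) (y := N)
        (by push_cast; linarith) (by push_cast; linarith) (by push_cast; linarith)
        (by push_cast; linarith)
      simp only [eval₂_polyF, eval₂_cst, eval₂_varX, eval₂_varY] at h
      push_cast at h
      exact h
    · have h := eval₂_nonneg_of_boxCheck (by norm_num) boxCheck_polyF_zero_high (x := s) (y := N)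
        (by push_cast; linarith) (by push_cast; linarith) (by push_cast; linarith)
        (by push_cast; linarith)
      simp only [eval₂_polyF, eval₂_cst, eval₂_varX, eval₂_varY] at h
      push_cast at h
      exact h

/-- `200` times the squared radius of the disc over which the convex body lies. -/
def discS (M : ℝ) : ℝ := 51 + -5 * M + -6 * (M * M)

theorem polyP_discS {M : ℝ} (hM0 : 0 ≤ M) (hM1 : M ≤ 1) :
    0 < polyP (fun n : ℤ => (n : ℝ)) (discS M / 200) M (3632 + 81840 * (discS M / 200)) ∧
      polyP (fun n : ℤ => (n : ℝ)) (discS M / 200) M (3632 + 81840 * (discS M / 200)) < 21 := by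
  have key : polyBdry (fun n : ℤ => (n : ℝ)) M (discS M) = 1600000000 *
      polyP (fun n : ℤ => (n : ℝ)) (discS M / 200) M (3632 + 81840 * (discS M / 200)) := by
    simp only [polyBdry, polyP]; push_cast; ring
  constructor
  · have : 0 ≤ polyBdry (fun n : ℤ => (n : ℝ)) M (discS M) + -1 := by
      rcases lt_or_ge M (1 / 4) with hM | hM
      · have h := eval₂_nonneg_of_boxCheck (by norm_num) boxCheck_polyBdry_pos_low (x := M) (y := 0)
          (by push_cast; linarith) (by push_cast; linarith) (by push_cast; linarith)
          (by push_cast; linarith)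
        simp only [eval₂_polyBdry, eval₂_add, eval₂_mul, eval₂_cst, eval₂_varX] at h
        push_cast at h
        exact h
      · have h := eval₂_nonneg_of_boxCheck (by norm_num) boxCheck_polyBdry_pos_high (x := M)
          (y := 0) (by push_cast; linarith) (by push_cast; linarith) (by push_cast; linarith)
          (by push_cast; linarith)
        simp only [eval₂_polyBdry, eval₂_add, eval₂_mul, eval₂_cst, eval₂_varX] at h
        push_cast at h
        exact h
    linarith
  · have h := eval₂_nonneg_of_boxCheck (by norm_num) boxCheck_polyBdry_lt (x := M) (y := 0)
      (by push_cast; linarith) (by push_cast; linarith) (by push_cast; linarith)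
      (by push_cast; linarith)
    simp only [eval₂_polyBdry, eval₂_add, eval₂_mul, eval₂_cst, eval₂_varX] at h
    push_cast at h
    change 0 ≤ 33599999999 + -1 * polyBdry (fun n : ℤ => (n : ℝ)) M (discS M) at h
    linarith

end realBounds

section convexityForm

/-- First derivative along a line of `-a s + 4 s³ + 2 μ s / N - 4 μ s t`, in terms of the first
derivatives `s₁`, `t₁` of `s = |z|²` and `t = Re z²`, where `k₁ = 1 / N` and `k₃ = 1 / N³`. -/
noncomputable def alongDeriv (a μ s t s₁ t₁ k₁ k₃ : ℝ) : ℝ :=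
  -a * s₁ + 12 * s ^ 2 * s₁ + 2 * μ * (s₁ * k₁ - s * (-4 * t₁ + 8 * s * s₁) / 2 * k₃)
    - 4 * μ * (s₁ * t + s * t₁)

/-- Second derivative along a line of `-a s + 4 s³ + 2 μ s / N - 4 μ s t`. -/
noncomputable def alongDeriv₂ (a μ s t s₁ t₁ s₂ t₂ k₁ k₃ k₅ : ℝ) : ℝ :=
  -a * s₂ + 24 * s * s₁ ^ 2 + 12 * s ^ 2 * s₂
    + 2 * μ * (s₂ * k₁ - s₁ * (-4 * t₁ + 8 * s * s₁) * k₃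
      - s * (-4 * t₂ + 8 * (s₁ ^ 2 + s * s₂)) / 2 * k₃
      + 3 / 4 * s * (-4 * t₁ + 8 * s * s₁) ^ 2 * k₅)
    - 4 * μ * (s₂ * t + 2 * s₁ * t₁ + s * t₂)

/-- The quadratic form in `v = (p, r)` whose nonnegativity at `z = (x, y)` yields the
convexity of the kinetic discs; `P` bounds the kinetic energy. -/
noncomputable def convForm (a μ x y p r k₁ k₃ k₅ P : ℝ) : ℝ :=
  -2 * alongDeriv₂ a μ (x ^ 2 + y ^ 2) (x ^ 2 - y ^ 2) (2 * (x * p + y * r)) (2 * (x * p - y * r))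
      (2 * (p ^ 2 + r ^ 2)) (2 * (p ^ 2 - r ^ 2)) k₁ k₃ k₅
    - 500 * (x ^ 2 + y ^ 2) * (x * p + y * r) *
      alongDeriv a μ (x ^ 2 + y ^ 2) (x ^ 2 - y ^ 2) (2 * (x * p + y * r)) (2 * (x * p - y * r))
        k₁ k₃
    - ((250 * (x ^ 2 + y ^ 2) * (x * p + y * r)) ^ 2 + 16 * (p ^ 2 + r ^ 2)) * P
    - 4 * ((x ^ 2 + y ^ 2) * (p ^ 2 + r ^ 2) + 8 * (x * p + y * r) ^ 2)

theorem convForm_polar {μ x y p r s N k Q : ℝ} (hs : s = x ^ 2 + y ^ 2)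
    (hN : N * N = 1 - 4 * (x ^ 2 - y ^ 2) + 4 * s ^ 2) (hk : N * N * N * N * N * k = 1) :
    3000 * (s * convForm (21 / 5 - μ ^ 2) μ x y p r (N * N * (N * N) * k) (N * N * k) k
      (polyP (fun n : ℤ => (n : ℝ)) s (2 * μ) Q / 3000)) =
    k * ((x * p + y * r) ^ 2 * polyA (fun n : ℤ => (n : ℝ)) s N (2 * μ) Q
      + 2 * (x * p + y * r) * (x * r - y * p) *
        (24000 * μ * x * y * polyY (fun n : ℤ => (n : ℝ)) s N)
      + (x * r - y * p) ^ 2 * polyD (fun n : ℤ => (n : ℝ)) s N (2 * μ) Q) := by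
  have hA : k * polyA (fun n : ℤ => (n : ℝ)) s N (2 * μ) Q =
      (-720000 * s ^ 2 + 600 * (84 - 20 * μ ^ 2 - 40 * μ) - 36000000 * s ^ 4
        + 150000 * (84 - 20 * μ ^ 2 - 40 * μ) * s ^ 2
        + (-62500 * s ^ 3 - 16) * polyP (fun n : ℤ => (n : ℝ)) s (2 * μ) Q - 108000 * s)
      - 12000 * μ * (3 * (1 + N * N - 4 * s ^ 2) ^ 2 * k
        + (-4 - 3 * (1 + N * N - 4 * s ^ 2)) * (N * N * k) + (-14 + 6 * (1 + N * N - 4 * s ^ 2)))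
      - 3000000 * s * μ * (s * (1 + N * N - 4 * s ^ 2) * (N * N * k)
        + (-6 * s + 2 * s * (1 + N * N - 4 * s ^ 2))) := by
    simp only [polyA, polyW]
    push_cast
    linear_combination ((-720000 * s ^ 2 + 600 * (84 - 20 * μ ^ 2 - 40 * μ) - 36000000 * s ^ 4
        + 150000 * (84 - 20 * μ ^ 2 - 40 * μ) * s ^ 2
        + (-62500 * s ^ 3 - 16) * polyP (fun n : ℤ => (n : ℝ)) s (2 * μ) Q - 108000 * s)
        - 12000 * μ * (-14 + 6 * (1 + N * N - 4 * s ^ 2))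
        - 3000000 * s * μ * (-6 * s + 2 * s * (1 + N * N - 4 * s ^ 2))) * hk
  have hD : k * polyD (fun n : ℤ => (n : ℝ)) s N (2 * μ) Q =
      (-144000 * s ^ 2 + 600 * (84 - 20 * μ ^ 2 - 40 * μ)
        - 16 * polyP (fun n : ℤ => (n : ℝ)) s (2 * μ) Q - 12000 * s)
      - 12000 * μ * ((8 + 3 * (1 + N * N - 4 * s ^ 2)) * (N * N * k)
        - 3 * (1 + N * N - 4 * s ^ 2) ^ 2 * k - 2) := by
    simp only [polyD, polyW]
    push_cast
    linear_combination (-144000 * s ^ 2 + 600 * (84 - 20 * μ ^ 2 - 40 * μ)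
        - 16 * polyP (fun n : ℤ => (n : ℝ)) s (2 * μ) Q - 12000 * s + 24000 * μ) * hk
  have hY : k * polyY (fun n : ℤ => (n : ℝ)) s N =
      12 * (k * (1 - 4 * s ^ 2) - 1) + 500 * s ^ 2 * (N * N * k - 1) := by
    simp only [polyY]
    push_cast
    linear_combination (-12 - 500 * s ^ 2) * hk
  generalize polyP (fun n : ℤ => (n : ℝ)) s (2 * μ) Q = P at *
  calc _ = (x * p + y * r) ^ 2 * (k * polyA (fun n : ℤ => (n : ℝ)) s N (2 * μ) Q)
      + 2 * (x * p + y * r) * (x * r - y * p) *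
        (24000 * μ * x * y * (k * polyY (fun n : ℤ => (n : ℝ)) s N))
      + (x * r - y * p) ^ 2 * (k * polyD (fun n : ℤ => (n : ℝ)) s N (2 * μ) Q) := by
        rw [hA, hD, hY]
        unfold convForm alongDeriv alongDeriv₂
        rw [hN, hs]
        ring
    _ = _ := by ring

theorem convForm_nonneg_of_formPos {μ x y p r s N k Q : ℝ} (hs : s = x ^ 2 + y ^ 2)
    (hN0 : 0 < N) (hN : N * N = 1 - 4 * (x ^ 2 - y ^ 2) + 4 * s ^ 2)
    (hk : N * N * N * N * N * k = 1) (h : FormPos s N (2 * μ) Q) :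
    0 ≤ convForm (21 / 5 - μ ^ 2) μ x y p r (N * N * (N * N) * k) (N * N * k) k
      (polyP (fun n : ℤ => (n : ℝ)) s (2 * μ) Q / 3000) := by
  have hk0 : 0 < k := by
    refine pos_of_mul_pos_right (a := N * N * N * N * N) ?_ (by positivity)
    rw [hk]; exact one_pos
  obtain ⟨hD, hF⟩ := h
  have hs0 : 0 ≤ s := by rw [hs]; positivity
  rcases hs0.eq_or_lt with h0 | hs0
  · subst h0
    have hx : x = 0 := by nlinarith [sq_nonneg x, sq_nonneg y]
    have hy : y = 0 := by nlinarith [sq_nonneg x, sq_nonneg y]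
    subst hx hy
    have hN1 : N = 1 := by nlinarith
    subst hN1
    have hk1 : k = 1 := by linarith
    subst hk1
    have key : 3000 * convForm (21 / 5 - μ ^ 2) μ 0 0 p r (1 * 1 * (1 * 1) * 1) (1 * 1 * 1) 1
        (polyP (fun n : ℤ => (n : ℝ)) 0 (2 * μ) Q / 3000) =
        (p ^ 2 + r ^ 2) * polyD (fun n : ℤ => (n : ℝ)) 0 1 (2 * μ) Q := by
      simp only [polyD, polyW]
      unfold convForm alongDeriv alongDeriv₂
      push_cast
      ring
    have : 0 ≤ (p ^ 2 + r ^ 2) * polyD (fun n : ℤ => (n : ℝ)) 0 1 (2 * μ) Q := by positivity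
    linarith
  · have key := convForm_polar (μ := μ) (p := p) (r := r) (Q := Q) hs hN hk
    set A := polyA (fun n : ℤ => (n : ℝ)) s N (2 * μ) Q with hA
    set D := polyD (fun n : ℤ => (n : ℝ)) s N (2 * μ) Q with hD'
    set Z := 24000 * μ * x * y * polyY (fun n : ℤ => (n : ℝ)) s N with hZ
    have hdet : 0 ≤ A * D - Z ^ 2 := by
      have : polyF (fun n : ℤ => (n : ℝ)) s N (2 * μ) Q = A * D - Z ^ 2 := by
        simp only [polyF, polyW, ← hA, ← hD', hZ]
        push_cast
        rw [hN, hs]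
        ring
      rwa [← this]
    have hpsd : 0 ≤ D * ((x * p + y * r) ^ 2 * A + 2 * (x * p + y * r) * (x * r - y * p) * Z
        + (x * r - y * p) ^ 2 * D) := by
      have : 0 ≤ (x * p + y * r) ^ 2 * (A * D - Z ^ 2) := by positivity
      nlinarith [sq_nonneg (D * (x * r - y * p) + (x * p + y * r) * Z)]
    have := nonneg_of_mul_nonneg_right hpsd hD
    have h2 := mul_nonneg hk0.le this
    rw [← key] at h2
    have h3 : 0 < 3000 * s := by positivity
    rw [← mul_assoc] at h2
    exact nonneg_of_mul_nonneg_right h2 h3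

theorem convForm_interpolate (μ ν c x y p r k₁ k₃ k₅ Q : ℝ) :
    ν * convForm (2 * c - μ ^ 2) μ x y p r k₁ k₃ k₅
        (polyP (fun n : ℤ => (n : ℝ)) (x ^ 2 + y ^ 2) (2 * μ) Q / 3000) =
      (ν - μ) * convForm (21 / 5 - 0 ^ 2) 0 x y p r k₁ k₃ k₅
        (polyP (fun n : ℤ => (n : ℝ)) (x ^ 2 + y ^ 2) (2 * 0) Q / 3000)
      + μ * convForm (21 / 5 - ν ^ 2) ν x y p r k₁ k₃ k₅
        (polyP (fun n : ℤ => (n : ℝ)) (x ^ 2 + y ^ 2) (2 * ν) Q / 3000)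
      + ν * μ * (ν - μ) * (4 * (p ^ 2 + r ^ 2)
        + 1000 * (x ^ 2 + y ^ 2) * (x * p + y * r) ^ 2
        + ((250 * (x ^ 2 + y ^ 2) * (x * p + y * r)) ^ 2 + 16 * (p ^ 2 + r ^ 2))
          * (x ^ 2 + y ^ 2))
      + ν * (c - 21 / 10) * (8 * (p ^ 2 + r ^ 2)
        + 2000 * (x ^ 2 + y ^ 2) * (x * p + y * r) ^ 2) := by
  unfold convForm alongDeriv alongDeriv₂ polyP
  push_cast
  ring

/-- `12000` times a bound for `1 / (1 - 2 s)`. -/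
noncomputable def chord (s : ℝ) : ℝ := if s < 1 / 5 then 12000 + 40000 * s else 3632 + 81840 * s

/-- An upper bound for the kinetic energy `|w + a(z)|²` on `|z|² = s`. -/
noncomputable def kinBound (μ s : ℝ) : ℝ :=
  polyP (fun n : ℤ => (n : ℝ)) s (2 * μ) (chord s) / 3000

theorem le_of_le_discS {μ s : ℝ} (hμ0 : 0 ≤ μ) (hs : s ≤ discS (2 * μ) / 200) :
    s ≤ 51 / 200 := by
  unfold discS at hs
  nlinarith

theorem sq_bounds {x y s N : ℝ} (hs : s = x ^ 2 + y ^ 2) (hs1 : s ≤ 51 / 200) (hN0 : 0 ≤ N)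
    (hN : N * N = 1 - 4 * (x ^ 2 - y ^ 2) + 4 * s ^ 2) : 1 - 2 * s ≤ N ∧ N ≤ 1 + 2 * s := by
  constructor
  · nlinarith [sq_nonneg y]
  · nlinarith [sq_nonneg x, sq_nonneg y]

theorem convForm_nonneg {μ c x y p r s N k : ℝ} (hμ0 : 0 ≤ μ) (hμ1 : μ ≤ 1 / 2)
    (hc : 21 / 10 ≤ c) (hs : s = x ^ 2 + y ^ 2) (hsS : s ≤ discS (2 * μ) / 200) (hN0 : 0 < N)
    (hN : N * N = 1 - 4 * (x ^ 2 - y ^ 2) + 4 * s ^ 2) (hk : N * N * N * N * N * k = 1) :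
    0 ≤ convForm (2 * c - μ ^ 2) μ x y p r (N * N * (N * N) * k) (N * N * k) k
      (kinBound μ s) := by
  have hs0 : 0 ≤ s := by rw [hs]; positivity
  have hs1 := le_of_le_discS hμ0 hsS
  obtain ⟨hNl, hNu⟩ := sq_bounds hs hs1 hN0.le hN
  suffices ∃ ν, 0 < ν ∧ μ ≤ ν ∧ FormPos s N (2 * ν) (chord s) by
    obtain ⟨ν, hν0, hμν, hF⟩ := this
    have h1 := convForm_nonneg_of_formPos (p := p) (r := r) hs hN0 hN hk hF
    have h0 : FormPos s N (2 * 0) (chord s) := by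
      rw [mul_zero]; exact formPos_zero hs0 hs1 hNl hNu _
    have h2 := convForm_nonneg_of_formPos (p := p) (r := r) hs hN0 hN hk h0
    have key := convForm_interpolate μ ν c x y p r (N * N * (N * N) * k) (N * N * k) k (chord s)
    rw [← hs] at key
    have e1 := mul_nonneg (sub_nonneg.2 hμν) h2
    have e2 := mul_nonneg hμ0 h1
    have hd : 0 ≤ ν - μ := sub_nonneg.2 hμν
    have hcd : 0 ≤ c - 21 / 10 := sub_nonneg.2 hc
    have e3 : 0 ≤ ν * μ * (ν - μ) * (4 * (p ^ 2 + r ^ 2) + 1000 * s * (x * p + y * r) ^ 2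
        + ((250 * s * (x * p + y * r)) ^ 2 + 16 * (p ^ 2 + r ^ 2)) * s) := by positivity
    have e4 : 0 ≤ ν * (c - 21 / 10) *
        (8 * (p ^ 2 + r ^ 2) + 2000 * s * (x * p + y * r) ^ 2) := by positivity
    refine nonneg_of_mul_nonneg_right (a := ν) ?_ hν0
    unfold kinBound
    rw [key]
    positivity
  unfold chord
  split_ifs with h
  · refine ⟨1 / 2, by norm_num, hμ1, ?_⟩
    have := formPos_inner hs0 h hNl hNu
    norm_num at this ⊢
    exact this
  · refine ⟨(3 + -10 * s) / 2, by linarith, ?_, ?_⟩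
    · unfold discS at hsS
      nlinarith [mul_nonneg (show 0 ≤ 1 - 2 * μ by linarith) (show 0 ≤ 3 / 2 - 2 * μ by linarith)]
    · rw [mul_div_cancel₀ _ two_ne_zero]
      exact formPos_outer (not_lt.1 h) hs1 hNl hNu

theorem kinBound_pos {μ s : ℝ} (hμ0 : 0 ≤ μ) (hμ1 : μ ≤ 1 / 2) (hs0 : 0 ≤ s)
    (hsS : s ≤ discS (2 * μ) / 200) : 0 < kinBound μ s := by
  have hs1 := le_of_le_discS hμ0 hsS
  have hM0 : 0 ≤ 2 * μ := by linarith
  have hM1 : 2 * μ ≤ 1 := by linarith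
  refine div_pos ?_ (by norm_num)
  generalize 2 * μ = M at *
  unfold chord
  split_ifs with h
  · have h3 : s ^ 3 ≤ 1 / 125 := by
      calc s ^ 3 ≤ (1 / 5) ^ 3 := pow_le_pow_left₀ hs0 h.le 3
        _ = 1 / 125 := by norm_num
    have h2 : s ^ 2 ≤ 1 / 25 := by
      calc s ^ 2 ≤ (1 / 5) ^ 2 := pow_le_pow_left₀ hs0 h.le 2
        _ = 1 / 25 := by norm_num
    have h7 : (0 : ℝ) < 7 := by norm_num
    have e1 : 0 ≤ (1 - M) * (1500 - 150 * s * (5 * (1 + M) + 20)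
        - s ^ 3 * (12000 + 40000 * s)) := by
      refine mul_nonneg (by linarith) ?_
      have : s * M ≤ 1 / 5 := by nlinarith
      have : s ^ 3 * s ≤ 1 / 125 * (1 / 5) := mul_le_mul h3 h.le hs0 (by norm_num)
      linarith
    have e2 : 0 ≤ (1 / 5 - s) * (8850 - 24000 * (s ^ 2 + s / 5 + 1 / 25)
        - 40000 * (s ^ 3 + s ^ 2 / 5 + s / 25 + 1 / 125)) :=
      mul_nonneg (by linarith) (by linarith)
    unfold polyP
    push_cast
    linear_combination e1 + e2 + h7
  · have h4 := (polyP_discS hM0 hM1).1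
    have hS : discS M / 200 ≤ 51 / 200 := by unfold discS; nlinarith
    generalize discS M / 200 = S at *
    have hS0 : 0 ≤ S := hs0.trans hsS
    have p2 : ∀ a b : ℝ, 0 ≤ a → a ≤ 51 / 200 → 0 ≤ b → b ≤ 51 / 200 → a * b ≤ 66 / 1000 := by
      intro a b _ _ _ _; nlinarith
    have q1 := p2 S S hS0 hS hS0 hS
    have q2 := p2 S s hS0 hS hs0 hs1
    have q3 := p2 s s hs0 hs1 hs0 hs1
    have p3 : ∀ a b : ℝ, 0 ≤ b → a ≤ 66 / 1000 → b ≤ 51 / 200 → a * b ≤ 17 / 1000 := by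
      intro a b _ _ _; nlinarith
    have r1 := p3 (S * S) S hS0 q1 hS
    have r2 := p3 (S * S) s hs0 q1 hs1
    have r3 := p3 (S * s) s hs0 q2 hs1
    have r4 := p3 (s * s) s hs0 q3 hs1
    have e0 : M * (3632 * (S * S + S * s + s * s)
        + 81840 * (S * S * S + S * S * s + S * s * s + s * s * s)) ≤
        1 * (3632 * (198 / 1000) + 81840 * (68 / 1000)) :=
      mul_le_mul hM1 (by linarith) (by positivity) (by norm_num)
    have e1 : 0 ≤ (S - s) * (150 * (84 - 5 * (M * M) - 20 * M)
        - 12000 * (S * S + S * s + s * s)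
        - M * (3632 * (S * S + S * s + s * s)
        + 81840 * (S * S * S + S * S * s + S * s * s + s * s * s))) := by
      refine mul_nonneg (by linarith) ?_
      nlinarith
    unfold polyP at h4 ⊢
    push_cast at h4 ⊢
    linear_combination h4 + e1

theorem chord_mul {s : ℝ} (hs0 : 0 ≤ s) (hs1 : s ≤ 51 / 200) :
    12000 ≤ chord s * (1 - 2 * s) := by
  unfold chord
  split_ifs with h
  · nlinarith
  · nlinarith

/-- The kinetic energy `|w + a(z)|²` at `z = x + i y` on the zero level set. -/
noncomputable def kin (μ c x y : ℝ) : ℝ :=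
  (1 - μ) - (2 * c - μ ^ 2) * (x ^ 2 + y ^ 2) + 4 * (x ^ 2 + y ^ 2) ^ 3
    + 2 * μ * ((x ^ 2 + y ^ 2) / lcAbs x y) - 4 * μ * ((x ^ 2 + y ^ 2) * (x ^ 2 - y ^ 2))

theorem lcAbs_nonneg (x y : ℝ) : 0 ≤ lcAbs x y := Real.sqrt_nonneg _

theorem lcAbs_mul_self (x y : ℝ) :
    lcAbs x y * lcAbs x y = 1 - 4 * (x ^ 2 - y ^ 2) + 4 * (x ^ 2 + y ^ 2) ^ 2 := by
  unfold lcAbs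
  rw [Real.mul_self_sqrt (by positivity)]
  ring

theorem lcAbs_pos {x y : ℝ} (h : x ^ 2 + y ^ 2 < 1 / 2) : 0 < lcAbs x y := by
  have h0 := lcAbs_nonneg x y
  have h1 := lcAbs_mul_self x y
  nlinarith [sq_nonneg x, sq_nonneg y]

theorem kin_le {μ c x y : ℝ} (hμ0 : 0 ≤ μ) (hc : 21 / 10 ≤ c)
    (hsS : x ^ 2 + y ^ 2 ≤ discS (2 * μ) / 200) :
    kin μ c x y ≤ kinBound μ (x ^ 2 + y ^ 2) - 7 / 1000 := by
  have hs1 := le_of_le_discS hμ0 hsS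
  have hN0 := lcAbs_pos (x := x) (y := y) (by linarith)
  have hN := lcAbs_mul_self x y
  obtain ⟨hNl, hNu⟩ := sq_bounds rfl hs1 hN0.le hN
  have hs0 : 0 ≤ x ^ 2 + y ^ 2 := by positivity
  have hq := chord_mul hs0 hs1
  unfold kin kinBound polyP
  generalize lcAbs x y = N at *
  generalize chord (x ^ 2 + y ^ 2) = Q at *
  generalize x ^ 2 + y ^ 2 = s at *
  generalize x ^ 2 - y ^ 2 = t at *
  have key : 1 ≤ N * (1 + 2 * t + 4 * s ^ 2 * (Q / 12000)) := by
    have hd : 0 < 1 - 2 * s := by linarith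
    refine le_of_mul_le_mul_left (a := 1 - 2 * s) ?_ hd
    have h1 : 0 ≤ 4 * s ^ 2 * N * (Q / 12000 * (1 - 2 * s) - 1) := by
      have : 0 ≤ Q / 12000 * (1 - 2 * s) - 1 := by linarith
      positivity
    have h2 : 0 ≤ (N - (1 - 2 * s)) * (2 - (1 - 2 * s) * N * (N + (1 - 2 * s))) := by
      refine mul_nonneg (by linarith) ?_
      have : N * (N + (1 - 2 * s)) ≤ (1 + 2 * s) * 2 :=
        mul_le_mul hNu (by linarith) (by positivity) (by positivity)
      nlinarith [mul_le_mul_of_nonneg_left this hd.le]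
    linear_combination h1 + h2 / 2 - (1 - 2 * s) * N / 2 * hN
  have h1 : s / N ≤ s * (1 + 2 * t + 4 * s ^ 2 * (Q / 12000)) := by
    rw [div_le_iff₀ hN0]
    nlinarith
  push_cast
  nlinarith [mul_le_mul_of_nonneg_left h1 hμ0, mul_nonneg (sub_nonneg.2 hc) hs0]

theorem kin_neg {μ c x y : ℝ} (hμ0 : 0 ≤ μ) (hμ1 : μ ≤ 1 / 2) (hc : 21 / 10 ≤ c)
    (hsS : x ^ 2 + y ^ 2 = discS (2 * μ) / 200) : kin μ c x y < 0 := by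
  refine (kin_le hμ0 hc hsS.le).trans_lt ?_
  have h := (polyP_discS (M := 2 * μ) (by linarith) (by linarith)).2
  have hS : ¬ discS (2 * μ) / 200 < 1 / 5 := by unfold discS; nlinarith
  rw [hsS, kinBound, chord, if_neg hS]
  linarith

end convexityForm

section lineCalculus

theorem pos_of_critical_concave {f f' f'' : ℝ → ℝ}
    (hf : ∀ τ ∈ Icc (0 : ℝ) 1, HasDerivAt f (f' τ) τ)
    (hf' : ∀ τ ∈ Icc (0 : ℝ) 1, HasDerivAt f' (f'' τ) τ)
    (h0 : 0 ≤ f 0) (h1 : 0 ≤ f 1) (hneg : ∀ τ ∈ Ioo (0 : ℝ) 1, f' τ = 0 → f'' τ < 0)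
    {τ : ℝ} (hτ : τ ∈ Ioo (0 : ℝ) 1) : 0 < f τ := by
  have no_min : ∀ σ ∈ Ioo (0 : ℝ) 1, ¬ IsMinOn f (Icc 0 1) σ := by
    intro σ hσ hmin
    have hloc : IsLocalMin f σ := hmin.isLocalMin (Icc_mem_nhds hσ.1 hσ.2)
    have hd : deriv f =ᶠ[nhds σ] f' := by
      filter_upwards [Icc_mem_nhds hσ.1 hσ.2] with u hu using (hf u hu).deriv
    have hσ' := Ioo_subset_Icc_self hσ
    have hc : f' σ = 0 := hloc.hasDerivAt_eq_zero (hf σ hσ')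
    have hdd : deriv (deriv f) σ = f'' σ := by rw [hd.deriv_eq, (hf' σ hσ').deriv]
    have hlt := hneg σ hσ hc
    have hmax : IsLocalMax f σ :=
      isLocalMax_of_deriv_deriv_neg (by rwa [hdd]) (by rw [hd.eq_of_nhds, hc])
        (hf σ hσ').continuousAt
    have hconst : f =ᶠ[nhds σ] fun _ => f σ := by
      filter_upwards [hloc, hmax] with u h1 h2 using le_antisymm h2 h1
    have hd0 : deriv f =ᶠ[nhds σ] fun _ => 0 := by
      simpa using hconst.deriv
    rw [← hdd, hd0.deriv_eq] at hlt
    simp at hlt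
  by_contra hle
  rw [not_lt] at hle
  obtain ⟨σ, hσ, hmin⟩ := isCompact_Icc.exists_isMinOn (nonempty_Icc.2 zero_le_one)
    (fun u hu => (hf u hu).continuousAt.continuousWithinAt)
  have hστ : f σ ≤ f τ := hmin (Ioo_subset_Icc_self hτ)
  have hσ0 : f τ ≤ f σ := by
    rcases eq_or_ne σ 0 with rfl | hσ0
    · exact hle.trans h0
    rcases eq_or_ne σ 1 with rfl | hσ1
    · exact hle.trans h1
    exact absurd hmin (no_min σ ⟨lt_of_le_of_ne hσ.1 hσ0.symm, lt_of_le_of_ne hσ.2 hσ1⟩)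
  exact no_min τ hτ fun u hu => hσ0.trans (hmin hu)

theorem concaveOn_sqrt_sub {f f' f'' g g' g'' : ℝ → ℝ}
    (hf : ∀ τ ∈ Icc (0 : ℝ) 1, HasDerivAt f (f' τ) τ)
    (hf' : ∀ τ ∈ Icc (0 : ℝ) 1, HasDerivAt f' (f'' τ) τ)
    (hg : ∀ τ, HasDerivAt g (g' τ) τ) (hg' : ∀ τ, HasDerivAt g' (g'' τ) τ)
    (hpos : ∀ τ ∈ Ioo (0 : ℝ) 1, 0 < f τ)
    (h : ∀ τ ∈ Ioo (0 : ℝ) 1,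
      2 * f τ * f'' τ - f' τ ^ 2 ≤ 4 * (f τ * √(f τ)) * g'' τ) :
    ConcaveOn ℝ (Icc 0 1) fun τ => √(f τ) - g τ := by
  refine concaveOn_of_hasDerivWithinAt2_nonpos (convex_Icc 0 1)
    (f' := fun τ => f' τ / (2 * √(f τ)) - g' τ)
    (f'' := fun τ => (f'' τ * (2 * √(f τ)) - f' τ * (2 * (f' τ / (2 * √(f τ)))))
      / (2 * √(f τ)) ^ 2 - g'' τ) ?_ ?_ ?_ ?_
  · intro τ hτ
    exact ((hf τ hτ).continuousAt.sqrt.sub (hg τ).continuousAt).continuousWithinAt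
  all_goals
    rw [interior_Icc]
    intro τ hτ
    have hτ' := Ioo_subset_Icc_self hτ
    have hp := hpos τ hτ
    have hsq : 0 < √(f τ) := Real.sqrt_pos.2 hp
  · exact (((hf τ hτ').sqrt hp.ne').sub (hg τ)).hasDerivWithinAt
  · refine (HasDerivAt.sub (HasDerivAt.div (hf' τ hτ') ?_ (by positivity)) (hg' τ)).hasDerivWithinAt
    exact ((hf τ hτ').sqrt hp.ne').const_mul 2
  · have h2 := h τ hτ
    have hff : f τ = √(f τ) ^ 2 := (Real.sq_sqrt hp.le).symm
    generalize √(f τ) = q at *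
    rw [hff] at h2
    have e : (f'' τ * (2 * q) - f' τ * (2 * (f' τ / (2 * q)))) / (2 * q) ^ 2 - g'' τ =
        (2 * q ^ 2 * f'' τ - f' τ ^ 2 - 4 * (q ^ 2 * q) * g'' τ) / (4 * q ^ 3) := by
      field_simp
      ring
    rw [e]
    exact div_nonpos_of_nonpos_of_nonneg (by linarith) (by positivity)

theorem hasDerivAt_alongDeriv {a μ τ s₂ t₂ : ℝ} {s t s₁ t₁ k : ℝ → ℝ}
    (hs : HasDerivAt s (s₁ τ) τ) (ht : HasDerivAt t (t₁ τ) τ)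
    (hs₁ : HasDerivAt s₁ s₂ τ) (ht₁ : HasDerivAt t₁ t₂ τ)
    (hk : HasDerivAt k (-((-4 * t₁ τ + 8 * s τ * s₁ τ) / 2 * k τ ^ 3)) τ) :
    HasDerivAt (fun u => alongDeriv a μ (s u) (t u) (s₁ u) (t₁ u) (k u) (k u ^ 3))
      (alongDeriv₂ a μ (s τ) (t τ) (s₁ τ) (t₁ τ) s₂ t₂ (k τ) (k τ ^ 3) (k τ ^ 5)) τ := by
  unfold alongDeriv alongDeriv₂
  have hE := ((ht₁.const_mul (-4)).add ((hs.const_mul 8).mul hs₁)).div_const 2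
  have h := (((hs₁.const_mul (-a)).add (((hs.pow 2).const_mul 12).mul hs₁)).add
    ((((hs₁.mul hk).sub ((hs.mul hE).mul (hk.pow 3)))).const_mul (2 * μ))).sub
    (((hs₁.mul ht).add (hs.mul ht₁)).const_mul (4 * μ))
  refine (h.congr_of_eventuallyEq (Filter.Eventually.of_forall fun u => ?_)).congr_deriv ?_
  · simp only [Pi.add_apply, Pi.sub_apply, Pi.mul_apply, Pi.pow_apply]
    ring
  · simp only [Pi.add_apply, Pi.mul_apply, Pi.pow_apply]
    push_cast
    ring

theorem hasDerivAt_potential {a μ τ : ℝ} {s t k : ℝ → ℝ} {s₁ t₁ : ℝ}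
    (hs : HasDerivAt s s₁ τ) (ht : HasDerivAt t t₁ τ)
    (hk : HasDerivAt k (-((-4 * t₁ + 8 * s τ * s₁) / 2 * k τ ^ 3)) τ) :
    HasDerivAt (fun u => (1 - μ) - a * s u + 4 * s u ^ 3 + 2 * μ * (s u * k u)
        - 4 * μ * (s u * t u))
      (alongDeriv a μ (s τ) (t τ) s₁ t₁ (k τ) (k τ ^ 3)) τ := by
  unfold alongDeriv
  have h := ((((hs.const_mul a).const_sub (1 - μ)).add ((hs.pow 3).const_mul 4)).add
    ((hs.mul hk).const_mul (2 * μ))).sub ((hs.mul ht).const_mul (4 * μ))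
  refine h.congr_deriv ?_
  push_cast
  ring

variable (x y p r : ℝ)

theorem hasDerivAt_normSq (τ : ℝ) :
    HasDerivAt (fun u => (x + u * p) ^ 2 + (y + u * r) ^ 2)
      (2 * ((x + τ * p) * p + (y + τ * r) * r)) τ := by
  have hX := ((hasDerivAt_id τ).mul_const p).const_add x
  have hY := ((hasDerivAt_id τ).mul_const r).const_add y
  refine ((hX.pow 2).add (hY.pow 2)).congr_deriv ?_
  simp only [id]
  push_cast
  ring

theorem hasDerivAt_reSq (τ : ℝ) :
    HasDerivAt (fun u => (x + u * p) ^ 2 - (y + u * r) ^ 2)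
      (2 * ((x + τ * p) * p - (y + τ * r) * r)) τ := by
  have hX := ((hasDerivAt_id τ).mul_const p).const_add x
  have hY := ((hasDerivAt_id τ).mul_const r).const_add y
  refine ((hX.pow 2).sub (hY.pow 2)).congr_deriv ?_
  simp only [id]
  push_cast
  ring

theorem hasDerivAt_normSq_deriv (τ : ℝ) :
    HasDerivAt (fun u => 2 * ((x + u * p) * p + (y + u * r) * r)) (2 * (p ^ 2 + r ^ 2)) τ := by
  have hX := ((hasDerivAt_id τ).mul_const p).const_add x
  have hY := ((hasDerivAt_id τ).mul_const r).const_add y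
  refine (((hX.mul_const p).add (hY.mul_const r)).const_mul 2).congr_deriv ?_
  ring

theorem hasDerivAt_reSq_deriv (τ : ℝ) :
    HasDerivAt (fun u => 2 * ((x + u * p) * p - (y + u * r) * r)) (2 * (p ^ 2 - r ^ 2)) τ := by
  have hX := ((hasDerivAt_id τ).mul_const p).const_add x
  have hY := ((hasDerivAt_id τ).mul_const r).const_add y
  refine (((hX.mul_const p).sub (hY.mul_const r)).const_mul 2).congr_deriv ?_
  ring

theorem hasDerivAt_inv_lcAbs {τ : ℝ} (h : (x + τ * p) ^ 2 + (y + τ * r) ^ 2 < 1 / 2) :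
    HasDerivAt (fun u => (lcAbs (x + u * p) (y + u * r))⁻¹)
      (-((-4 * (2 * ((x + τ * p) * p - (y + τ * r) * r)) + 8 * ((x + τ * p) ^ 2 + (y + τ * r) ^ 2)
        * (2 * ((x + τ * p) * p + (y + τ * r) * r))) / 2
        * (lcAbs (x + τ * p) (y + τ * r))⁻¹ ^ 3)) τ := by
  have hN := lcAbs_pos h
  have heq : (fun u => lcAbs (x + u * p) (y + u * r)) =
      fun u => √(1 - 4 * ((x + u * p) ^ 2 - (y + u * r) ^ 2)
        + 4 * ((x + u * p) ^ 2 + (y + u * r) ^ 2) ^ 2) := by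
    funext u
    rw [← lcAbs_mul_self, Real.sqrt_mul_self (lcAbs_nonneg _ _)]
  have hne : 1 - 4 * ((x + τ * p) ^ 2 - (y + τ * r) ^ 2)
        + 4 * ((x + τ * p) ^ 2 + (y + τ * r) ^ 2) ^ 2 ≠ 0 := by
    rw [← lcAbs_mul_self]; positivity
  have h1 := ((((hasDerivAt_reSq x y p r τ).const_mul 4).const_sub 1).add
    (((hasDerivAt_normSq x y p r τ).pow 2).const_mul 4)).sqrt hne
  have h2 : HasDerivAt (fun u => lcAbs (x + u * p) (y + u * r)) _ τ := heq ▸ h1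
  have h3 := h2.inv hN.ne'
  refine h3.congr_deriv ?_
  simp only [Pi.add_apply, Pi.pow_apply]
  rw [← lcAbs_mul_self, Real.sqrt_mul_self (lcAbs_nonneg _ _)]
  generalize lcAbs (x + τ * p) (y + τ * r) = N at *
  field_simp
  push_cast
  ring

theorem convForm_kinBound_nonneg {μ c x y : ℝ} (hμ0 : 0 ≤ μ) (hμ1 : μ ≤ 1 / 2) (hc : 21 / 10 ≤ c)
    (hsS : x ^ 2 + y ^ 2 ≤ discS (2 * μ) / 200) :
    0 ≤ convForm (2 * c - μ ^ 2) μ x y p r (lcAbs x y)⁻¹ ((lcAbs x y)⁻¹ ^ 3) ((lcAbs x y)⁻¹ ^ 5)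
      (kinBound μ (x ^ 2 + y ^ 2)) := by
  have hs1 := le_of_le_discS hμ0 hsS
  have hN0 := lcAbs_pos (x := x) (y := y) (by linarith)
  have h := convForm_nonneg (p := p) (r := r) (k := (lcAbs x y)⁻¹ ^ 5) hμ0 hμ1 hc rfl hsS hN0
    (lcAbs_mul_self x y) (by field_simp)
  convert h using 2 <;> field_simp

theorem kin_add_mul (μ c τ : ℝ) : kin μ c (x + τ * p) (y + τ * r) =
    (1 - μ) - (2 * c - μ ^ 2) * ((x + τ * p) ^ 2 + (y + τ * r) ^ 2)
      + 4 * ((x + τ * p) ^ 2 + (y + τ * r) ^ 2) ^ 3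
      + 2 * μ * (((x + τ * p) ^ 2 + (y + τ * r) ^ 2) * (lcAbs (x + τ * p) (y + τ * r))⁻¹)
      - 4 * μ * (((x + τ * p) ^ 2 + (y + τ * r) ^ 2) * ((x + τ * p) ^ 2 - (y + τ * r) ^ 2)) := by
  unfold kin
  rw [div_eq_mul_inv]

/-- First component of the vector field `a(z)` completing the square in the momentum. -/
def shift₁ (μ x y : ℝ) : ℝ := -(2 * (x ^ 2 + y ^ 2) * y) - μ * y

/-- Second component of the vector field `a(z)` completing the square in the momentum. -/
def shift₂ (μ x y : ℝ) : ℝ := 2 * (x ^ 2 + y ^ 2) * x - μ * x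

variable {x y p r}

theorem kin_pos_and_concaveOn {μ c : ℝ} (e₁ e₂ : ℝ) (he : e₁ ^ 2 + e₂ ^ 2 = 1)
    (hμ0 : 0 ≤ μ) (hμ1 : μ ≤ 1 / 2) (hc : 21 / 10 ≤ c) (hV : 0 < p ^ 2 + r ^ 2)
    (hB : ∀ τ ∈ Icc (0 : ℝ) 1, (x + τ * p) ^ 2 + (y + τ * r) ^ 2 ≤ discS (2 * μ) / 200)
    (h0 : 0 ≤ kin μ c (x + 0 * p) (y + 0 * r)) (h1 : 0 ≤ kin μ c (x + 1 * p) (y + 1 * r)) :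
    (∀ τ ∈ Ioo (0 : ℝ) 1, 0 < kin μ c (x + τ * p) (y + τ * r)) ∧
    ConcaveOn ℝ (Icc 0 1) fun τ => √(kin μ c (x + τ * p) (y + τ * r))
      - (e₁ * shift₁ μ (x + τ * p) (y + τ * r) + e₂ * shift₂ μ (x + τ * p) (y + τ * r)) := by
  set f' : ℝ → ℝ := fun τ => alongDeriv (2 * c - μ ^ 2) μ ((x + τ * p) ^ 2 + (y + τ * r) ^ 2)
    ((x + τ * p) ^ 2 - (y + τ * r) ^ 2) (2 * ((x + τ * p) * p + (y + τ * r) * r))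
    (2 * ((x + τ * p) * p - (y + τ * r) * r)) (lcAbs (x + τ * p) (y + τ * r))⁻¹
    ((lcAbs (x + τ * p) (y + τ * r))⁻¹ ^ 3) with hf_fst
  set f'' : ℝ → ℝ := fun τ => alongDeriv₂ (2 * c - μ ^ 2) μ ((x + τ * p) ^ 2 + (y + τ * r) ^ 2)
    ((x + τ * p) ^ 2 - (y + τ * r) ^ 2) (2 * ((x + τ * p) * p + (y + τ * r) * r))
    (2 * ((x + τ * p) * p - (y + τ * r) * r)) (2 * (p ^ 2 + r ^ 2)) (2 * (p ^ 2 - r ^ 2))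
    (lcAbs (x + τ * p) (y + τ * r))⁻¹ ((lcAbs (x + τ * p) (y + τ * r))⁻¹ ^ 3)
    ((lcAbs (x + τ * p) (y + τ * r))⁻¹ ^ 5) with hf_snd
  have hhalf : ∀ τ ∈ Icc (0 : ℝ) 1, (x + τ * p) ^ 2 + (y + τ * r) ^ 2 < 1 / 2 := fun τ hτ => by
    linarith [le_of_le_discS hμ0 (hB τ hτ)]
  have hf : ∀ τ ∈ Icc (0 : ℝ) 1,
      HasDerivAt (fun τ => kin μ c (x + τ * p) (y + τ * r)) (f' τ) τ := by
    intro τ hτ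
    simp only [kin_add_mul]
    exact hasDerivAt_potential (hasDerivAt_normSq x y p r τ) (hasDerivAt_reSq x y p r τ)
      (hasDerivAt_inv_lcAbs x y p r (hhalf τ hτ))
  have hf' : ∀ τ ∈ Icc (0 : ℝ) 1, HasDerivAt f' (f'' τ) τ := fun τ hτ =>
    hasDerivAt_alongDeriv (hasDerivAt_normSq x y p r τ) (hasDerivAt_reSq x y p r τ)
      (hasDerivAt_normSq_deriv x y p r τ) (hasDerivAt_reSq_deriv x y p r τ)
      (hasDerivAt_inv_lcAbs x y p r (hhalf τ hτ))
  have hform : ∀ τ ∈ Icc (0 : ℝ) 1, ∃ b P, 0 < P ∧ kin μ c (x + τ * p) (y + τ * r) ≤ P ∧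
      0 ≤ -2 * f'' τ - b * f' τ * 2 - (b ^ 2 + 16 * (p ^ 2 + r ^ 2)) * P
        - 4 * (((x + τ * p) ^ 2 + (y + τ * r) ^ 2) * (p ^ 2 + r ^ 2)
          + 8 * ((x + τ * p) * p + (y + τ * r) * r) ^ 2) := by
    intro τ hτ
    have hs0 : 0 ≤ (x + τ * p) ^ 2 + (y + τ * r) ^ 2 := by positivity
    refine ⟨250 * ((x + τ * p) ^ 2 + (y + τ * r) ^ 2) * ((x + τ * p) * p + (y + τ * r) * r),
      _, kinBound_pos hμ0 hμ1 hs0 (hB τ hτ), (kin_le hμ0 hc (hB τ hτ)).trans (by linarith), ?_⟩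
    refine (convForm_kinBound_nonneg p r hμ0 hμ1 hc (hB τ hτ)).trans_eq ?_
    unfold convForm
    rw [hf_fst, hf_snd]
    ring
  have hpos : ∀ τ ∈ Ioo (0 : ℝ) 1, 0 < kin μ c (x + τ * p) (y + τ * r) := by
    intro τ hτ
    refine pos_of_critical_concave hf hf' h0 h1 (fun σ hσ hσ0 => ?_) hτ
    obtain ⟨b, P, hP, -, hform⟩ := hform σ (Ioo_subset_Icc_self hσ)
    rw [hσ0] at hform
    have : 0 < 16 * (p ^ 2 + r ^ 2) * P := by positivity
    have : 0 ≤ b ^ 2 * P := by positivity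
    have : 0 ≤ 4 * (((x + σ * p) ^ 2 + (y + σ * r) ^ 2) * (p ^ 2 + r ^ 2)
          + 8 * ((x + σ * p) * p + (y + σ * r) * r) ^ 2) := by positivity
    linarith
  refine ⟨hpos, concaveOn_sqrt_sub hf hf'
    (g' := fun τ => e₁ * (-(2 * (2 * ((x + τ * p) * p + (y + τ * r) * r)) * (y + τ * r)
      + 2 * ((x + τ * p) ^ 2 + (y + τ * r) ^ 2) * r) - μ * r)
      + e₂ * (2 * (2 * ((x + τ * p) * p + (y + τ * r) * r)) * (x + τ * p)
      + 2 * ((x + τ * p) ^ 2 + (y + τ * r) ^ 2) * p - μ * p))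
    (g'' := fun τ => 4 * (-e₁ * ((p ^ 2 + r ^ 2) * (y + τ * r)
        + 2 * ((x + τ * p) * p + (y + τ * r) * r) * r)
      + e₂ * ((p ^ 2 + r ^ 2) * (x + τ * p) + 2 * ((x + τ * p) * p + (y + τ * r) * r) * p)))
    (fun τ => ?_) (fun τ => ?_) hpos (fun τ hτ => ?_)⟩
  · have hX := ((hasDerivAt_id τ).mul_const p).const_add x
    have hY := ((hasDerivAt_id τ).mul_const r).const_add y
    have hS := (hasDerivAt_normSq x y p r τ).const_mul 2
    refine ((((hS.mul hY).neg.sub (hY.const_mul μ)).const_mul e₁).add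
      (((hS.mul hX).sub (hX.const_mul μ)).const_mul e₂)).congr_deriv ?_
    simp only [id]
    ring
  · have hX := ((hasDerivAt_id τ).mul_const p).const_add x
    have hY := ((hasDerivAt_id τ).mul_const r).const_add y
    have hS := (hasDerivAt_normSq x y p r τ).const_mul 2
    have hS₁ := (hasDerivAt_normSq_deriv x y p r τ).const_mul 2
    refine (((((hS₁.mul hY).add (hS.mul_const r)).neg.sub_const (μ * r)).const_mul e₁).add
      ((((hS₁.mul hX).add (hS.mul_const p)).sub_const (μ * p)).const_mul e₂)).congr_deriv ?_
    simp only [id]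
    ring
  · obtain ⟨b, P, -, hP, hform⟩ := hform τ (Ioo_subset_Icc_self hτ)
    have hφ := hpos τ hτ
    generalize f' τ = F₁ at *
    generalize f'' τ = F₂ at *
    generalize kin μ c (x + τ * p) (y + τ * r) = φ at *
    generalize x + τ * p = X at *
    generalize y + τ * r = Y at *
    have hq : 0 < √φ := Real.sqrt_pos.2 hφ
    have hqφ : √φ * √φ = φ := Real.mul_self_sqrt hφ.le
    generalize √φ = q at *
    set G := -e₁ * ((p ^ 2 + r ^ 2) * Y + 2 * (X * p + Y * r) * r)
      + e₂ * ((p ^ 2 + r ^ 2) * X + 2 * (X * p + Y * r) * p) with hG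
    set W := (X ^ 2 + Y ^ 2) * (p ^ 2 + r ^ 2) + 8 * (X * p + Y * r) ^ 2 with hW
    have hW0 : 0 ≤ W := by positivity
    have hGW : G ^ 2 ≤ (p ^ 2 + r ^ 2) * W := by
      have hid : (p ^ 2 + r ^ 2) * W = G ^ 2
          + (e₁ * ((p ^ 2 + r ^ 2) * X + 2 * (X * p + Y * r) * p)
            + e₂ * ((p ^ 2 + r ^ 2) * Y + 2 * (X * p + Y * r) * r)) ^ 2 := by
        rw [hG, hW]
        linear_combination (-((p ^ 2 + r ^ 2) * Y + 2 * (X * p + Y * r) * r) ^ 2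
          - ((p ^ 2 + r ^ 2) * X + 2 * (X * p + Y * r) * p) ^ 2) * he
      rw [hid]
      exact le_add_of_nonneg_right (sq_nonneg _)
    clear_value G W
    have hGq : -(4 * q * (4 * G)) ≤ 16 * (p ^ 2 + r ^ 2) * φ + 4 * W := by
      refine (neg_le_abs _).trans (abs_le_of_sq_le_sq ?_ (by positivity))
      have h1 : 256 * (q * q) * G ^ 2 ≤ 256 * φ * ((p ^ 2 + r ^ 2) * W) := by
        rw [hqφ]; gcongr
      linear_combination h1 + sq_nonneg (16 * (p ^ 2 + r ^ 2) * φ - 4 * W)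
    have hform' : 0 ≤ -2 * F₂ - b * F₁ * 2 - (b ^ 2 + 16 * (p ^ 2 + r ^ 2)) * φ - 4 * W := by
      have : (b ^ 2 + 16 * (p ^ 2 + r ^ 2)) * φ ≤ (b ^ 2 + 16 * (p ^ 2 + r ^ 2)) * P := by
        gcongr
      linarith
    linear_combination φ * hform' + φ * hGq + sq_nonneg (F₁ + b * φ)

end lineCalculus

section convexBody

theorem mul_add_mul_le_sqrt {e₁ e₂ A B φ : ℝ} (he : e₁ ^ 2 + e₂ ^ 2 = 1)
    (h : A ^ 2 + B ^ 2 ≤ φ) : e₁ * A + e₂ * B ≤ √φ := by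
  refine Real.le_sqrt_of_sq_le ((le_of_eq_of_le ?_ (sub_le_self _ (sq_nonneg
    (e₁ * B - e₂ * A)))).trans h)
  linear_combination (A ^ 2 + B ^ 2) * he

theorem momentum_segment {μ c x y p r w₁ w₂ v₁ v₂ τ : ℝ}
    (hμ0 : 0 ≤ μ) (hμ1 : μ ≤ 1 / 2) (hc : 21 / 10 ≤ c) (hτ : τ ∈ Ioo (0 : ℝ) 1)
    (hB : ∀ τ ∈ Icc (0 : ℝ) 1, (x + τ * p) ^ 2 + (y + τ * r) ^ 2 ≤ discS (2 * μ) / 200)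
    (hw : (w₁ + shift₁ μ x y) ^ 2 + (w₂ + shift₂ μ x y) ^ 2 ≤ kin μ c x y)
    (hv : (v₁ + shift₁ μ (x + p) (y + r)) ^ 2 + (v₂ + shift₂ μ (x + p) (y + r)) ^ 2 ≤
      kin μ c (x + p) (y + r)) :
    ((1 - τ) * w₁ + τ * v₁ + shift₁ μ (x + τ * p) (y + τ * r)) ^ 2
      + ((1 - τ) * w₂ + τ * v₂ + shift₂ μ (x + τ * p) (y + τ * r)) ^ 2 ≤
      kin μ c (x + τ * p) (y + τ * r) := by
  have hτ0 : 0 < 1 - τ := sub_pos.2 hτ.2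
  have hτ1 : 0 < τ := hτ.1
  have hτ0' : 0 ≤ 1 - τ := hτ0.le
  rcases (show 0 ≤ p ^ 2 + r ^ 2 by positivity).eq_or_lt with hV | hV
  · have hp : p = 0 := by nlinarith [sq_nonneg p, sq_nonneg r]
    have hr : r = 0 := by nlinarith [sq_nonneg p, sq_nonneg r]
    subst hp hr
    simp only [add_zero, mul_zero] at hv ⊢
    generalize shift₁ μ x y = a at *
    generalize shift₂ μ x y = b at *
    have h3 : 0 ≤ τ * (1 - τ) * ((w₁ - v₁) ^ 2 + (w₂ - v₂) ^ 2) :=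
      mul_nonneg (mul_nonneg hτ.1.le hτ0.le) (by positivity)
    linear_combination mul_le_mul_of_nonneg_left hw hτ0' + mul_le_mul_of_nonneg_left hv hτ1.le + h3
  · have h0 : 0 ≤ kin μ c (x + 0 * p) (y + 0 * r) := by
      rw [zero_mul, zero_mul, add_zero, add_zero]
      exact le_trans (by positivity) hw
    have h1 : 0 ≤ kin μ c (x + 1 * p) (y + 1 * r) := by
      rw [one_mul, one_mul]
      exact le_trans (by positivity) hv
    have hφ := (kin_pos_and_concaveOn 1 0 (by norm_num) hμ0 hμ1 hc hV hB h0 h1).1 τ hτ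
    set A := (1 - τ) * w₁ + τ * v₁ + shift₁ μ (x + τ * p) (y + τ * r) with hA
    set B := (1 - τ) * w₂ + τ * v₂ + shift₂ μ (x + τ * p) (y + τ * r) with hB'
    rcases (show 0 ≤ A ^ 2 + B ^ 2 by positivity).eq_or_lt with hAB | hAB
    · rw [← hAB]; exact hφ.le
    have hn : 0 < √(A ^ 2 + B ^ 2) := Real.sqrt_pos.2 hAB
    have hnn : √(A ^ 2 + B ^ 2) * √(A ^ 2 + B ^ 2) = A ^ 2 + B ^ 2 := Real.mul_self_sqrt hAB.le
    have he : (A / √(A ^ 2 + B ^ 2)) ^ 2 + (B / √(A ^ 2 + B ^ 2)) ^ 2 = 1 := by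
      rw [div_pow, div_pow, ← add_div, Real.sq_sqrt hAB.le, div_self hAB.ne']
    have hconc := (kin_pos_and_concaveOn _ _ he hμ0 hμ1 hc hV hB h0 h1).2
    have hcw := mul_add_mul_le_sqrt he hw
    have hcv := mul_add_mul_le_sqrt he hv
    have key := hconc.2 (left_mem_Icc.2 zero_le_one) (right_mem_Icc.2 zero_le_one) hτ0.le hτ.1.le
      (by ring)
    simp only [smul_eq_mul, zero_mul, one_mul, mul_zero, mul_one, zero_add, add_zero] at key
    have hunit : A / √(A ^ 2 + B ^ 2) * A + B / √(A ^ 2 + B ^ 2) * B = √(A ^ 2 + B ^ 2) := by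
      rw [div_mul_eq_mul_div, div_mul_eq_mul_div, ← add_div, div_eq_iff hn.ne', hnn]
      ring
    generalize A / √(A ^ 2 + B ^ 2) = e₁ at *
    generalize B / √(A ^ 2 + B ^ 2) = e₂ at *
    rw [← Real.sqrt_le_sqrt_iff hφ.le, ← hunit, hA, hB']
    linear_combination key + mul_le_mul_of_nonneg_left hcw hτ0'
      + mul_le_mul_of_nonneg_left hcv hτ1.le

/-- The convex body bounded by `Σ_{μ,c}`. -/
def convexBody (μ c : ℝ) : Set V4 :=
  {X | X 0 ^ 2 + X 1 ^ 2 ≤ discS (2 * μ) / 200 ∧ Kham μ c X ≤ 0}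

theorem two_mul_Kham (μ c : ℝ) (X : V4) : 2 * Kham μ c X =
    (X 2 + shift₁ μ (X 0) (X 1)) ^ 2 + (X 3 + shift₂ μ (X 0) (X 1)) ^ 2
      - kin μ c (X 0) (X 1) := by
  unfold Kham shift₁ shift₂ kin
  ring

theorem Kham_nonpos_iff {μ c : ℝ} {X : V4} : Kham μ c X ≤ 0 ↔
    (X 2 + shift₁ μ (X 0) (X 1)) ^ 2 + (X 3 + shift₂ μ (X 0) (X 1)) ^ 2 ≤
      kin μ c (X 0) (X 1) := by
  have := two_mul_Kham μ c X
  constructor <;> intro <;> linarith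

theorem convex_convexBody {μ c : ℝ} (hμ0 : 0 ≤ μ) (hμ1 : μ ≤ 1 / 2) (hc : 21 / 10 ≤ c) :
    Convex ℝ (convexBody μ c) := by
  rw [convex_iff_forall_pos]
  rintro X ⟨hX, hXK⟩ Y ⟨hY, hYK⟩ a b ha hb hab
  have hseg : ∀ τ ∈ Icc (0 : ℝ) 1,
      (X 0 + τ * (Y 0 - X 0)) ^ 2 + (X 1 + τ * (Y 1 - X 1)) ^ 2 ≤ discS (2 * μ) / 200 := by
    intro τ hτ
    have h3 : 0 ≤ τ * (1 - τ) * ((Y 0 - X 0) ^ 2 + (Y 1 - X 1) ^ 2) :=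
      mul_nonneg (mul_nonneg hτ.1 (sub_nonneg.2 hτ.2)) (by positivity)
    linear_combination mul_le_mul_of_nonneg_left hX (sub_nonneg.2 hτ.2)
      + mul_le_mul_of_nonneg_left hY hτ.1 + h3
  have hb1 : b ∈ Ioo (0 : ℝ) 1 := ⟨hb, by linarith⟩
  have ha1 : a = 1 - b := by linarith
  rw [Kham_nonpos_iff] at hXK hYK
  have key := momentum_segment (p := Y 0 - X 0) (r := Y 1 - X 1) hμ0 hμ1 hc hb1 hseg hXK
    (by rwa [add_sub_cancel, add_sub_cancel])
  have e0 : (a • X + b • Y) 0 = X 0 + b * (Y 0 - X 0) := by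
    simp only [Pi.add_apply, Pi.smul_apply, smul_eq_mul, ha1]; ring
  have e1 : (a • X + b • Y) 1 = X 1 + b * (Y 1 - X 1) := by
    simp only [Pi.add_apply, Pi.smul_apply, smul_eq_mul, ha1]; ring
  have e2 : (a • X + b • Y) 2 = (1 - b) * X 2 + b * Y 2 := by
    simp only [Pi.add_apply, Pi.smul_apply, smul_eq_mul, ha1]
  have e3 : (a • X + b • Y) 3 = (1 - b) * X 3 + b * Y 3 := by
    simp only [Pi.add_apply, Pi.smul_apply, smul_eq_mul, ha1]
  refine ⟨?_, Kham_nonpos_iff.2 ?_⟩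
  · rw [e0, e1]
    exact hseg b (Ioo_subset_Icc_self hb1)
  · rw [e0, e1, e2, e3]
    exact key

theorem continuousAt_Kham {μ c : ℝ} {X : V4} (h : X ∈ LCDom) : ContinuousAt (Kham μ c) X := by
  have h' : lcAbs (X 0) (X 1) ≠ 0 := h
  unfold Kham
  have hl : Continuous fun Y : V4 => lcAbs (Y 0) (Y 1) := by unfold lcAbs; fun_prop
  have hd : ContinuousAt (fun Y : V4 => μ * (Y 0 ^ 2 + Y 1 ^ 2) / lcAbs (Y 0) (Y 1)) X :=
    ContinuousAt.div (by fun_prop) hl.continuousAt h'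
  exact ContinuousAt.sub (by fun_prop) hd

theorem mem_LCDom {μ : ℝ} {X : V4} (hμ0 : 0 ≤ μ) (h : X 0 ^ 2 + X 1 ^ 2 ≤ discS (2 * μ) / 200) :
    X ∈ LCDom :=
  (lcAbs_pos (by linarith [le_of_le_discS hμ0 h])).ne'

theorem Kham_pos_of_eq {μ c : ℝ} {X : V4} (hμ0 : 0 ≤ μ) (hμ1 : μ ≤ 1 / 2) (hc : 21 / 10 ≤ c)
    (h : X 0 ^ 2 + X 1 ^ 2 = discS (2 * μ) / 200) : 0 < Kham μ c X := by
  have := two_mul_Kham μ c X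
  have := kin_neg hμ0 hμ1 hc h
  nlinarith [sq_nonneg (X 2 + shift₁ μ (X 0) (X 1)), sq_nonneg (X 3 + shift₂ μ (X 0) (X 1))]

theorem isClosed_convexBody {μ : ℝ} (c : ℝ) (hμ0 : 0 ≤ μ) : IsClosed (convexBody μ c) := by
  have hD : IsClosed {X : V4 | X 0 ^ 2 + X 1 ^ 2 ≤ discS (2 * μ) / 200} :=
    isClosed_le (by fun_prop) (by fun_prop)
  have hK : ContinuousOn (Kham μ c) {X : V4 | X 0 ^ 2 + X 1 ^ 2 ≤ discS (2 * μ) / 200} :=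
    fun X hX => (continuousAt_Kham (mem_LCDom hμ0 hX)).continuousWithinAt
  exact hK.preimage_isClosed_of_isClosed hD isClosed_Iic

theorem kin_le_four {μ c x y : ℝ} (hμ0 : 0 ≤ μ) (hμ1 : μ ≤ 1 / 2) (hc : 21 / 10 ≤ c)
    (hs1 : x ^ 2 + y ^ 2 ≤ 51 / 200) : kin μ c x y ≤ 4 := by
  have hN0 := lcAbs_pos (x := x) (y := y) (by linarith)
  have hNl := (sq_bounds rfl hs1 hN0.le (lcAbs_mul_self x y)).1
  have hs0 : 0 ≤ x ^ 2 + y ^ 2 := by positivity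
  have ht : -(x ^ 2 - y ^ 2) ≤ 51 / 200 := by linarith [sq_nonneg x]
  have hq : (x ^ 2 + y ^ 2) / lcAbs x y ≤ 1 := by
    rw [div_le_one hN0]
    linarith
  unfold kin
  generalize (x ^ 2 + y ^ 2) / lcAbs x y = q at *
  generalize x ^ 2 + y ^ 2 = s at *
  have h3 : s ^ 3 ≤ (51 / 200) ^ 3 := pow_le_pow_left₀ hs0 hs1 3
  have h1 : μ * q ≤ 1 / 2 := by nlinarith
  have h2 : s * -(x ^ 2 - y ^ 2) ≤ 1 / 8 := by nlinarith
  have h2' : μ * (s * -(x ^ 2 - y ^ 2)) ≤ 1 / 8 := by nlinarith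
  have h4 : 0 ≤ (2 * c - μ ^ 2) * s := mul_nonneg (by nlinarith) hs0
  linarith

theorem isCompact_convexBody {μ c : ℝ} (hμ0 : 0 ≤ μ) (hμ1 : μ ≤ 1 / 2) (hc : 21 / 10 ≤ c) :
    IsCompact (convexBody μ c) := by
  refine Metric.isCompact_of_isClosed_isBounded (isClosed_convexBody c hμ0) ?_
  refine (Metric.isBounded_closedBall (x := (0 : V4)) (r := 5)).subset ?_
  rintro X ⟨hX, hXK⟩
  rw [mem_closedBall_zero_iff, pi_norm_le_iff_of_nonneg (by norm_num)]
  have hs1 := le_of_le_discS hμ0 hX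
  rw [Kham_nonpos_iff] at hXK
  replace hXK := hXK.trans (kin_le_four hμ0 hμ1 hc hs1)
  have hx : |X 0| ≤ 1 := by
    rw [← sq_le_one_iff_abs_le_one]; nlinarith [sq_nonneg (X 1)]
  have hy : |X 1| ≤ 1 := by
    rw [← sq_le_one_iff_abs_le_one]; nlinarith [sq_nonneg (X 0)]
  have h2 : |X 2 + shift₁ μ (X 0) (X 1)| ≤ 2 := by
    refine abs_le_of_sq_le_sq ?_ (by norm_num)
    linarith [sq_nonneg (X 3 + shift₂ μ (X 0) (X 1))]
  have h3 : |X 3 + shift₂ μ (X 0) (X 1)| ≤ 2 := by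
    refine abs_le_of_sq_le_sq ?_ (by norm_num)
    linarith [sq_nonneg (X 2 + shift₁ μ (X 0) (X 1))]
  have hs0 : 0 ≤ X 0 ^ 2 + X 1 ^ 2 := by positivity
  have hb : ∀ m u : ℝ, |m| ≤ 2 → |u| ≤ 1 → |m * u| ≤ 2 := fun m u hm hu => by
    rw [abs_mul]
    nlinarith [abs_nonneg m, abs_nonneg u]
  have e1 := hb (2 * (X 0 ^ 2 + X 1 ^ 2) + μ) (X 1)
    (abs_le.2 ⟨by linarith, by linarith⟩) hy
  have e2 := hb (2 * (X 0 ^ 2 + X 1 ^ 2) - μ) (X 0)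
    (abs_le.2 ⟨by linarith, by linarith⟩) hx
  unfold shift₁ at h2
  unfold shift₂ at h3
  rw [abs_le] at hx hy h2 h3 e1 e2
  intro i
  rw [Real.norm_eq_abs, abs_le]
  fin_cases i <;> simp only [Fin.zero_eta, Fin.mk_one, Fin.reduceFinMk] <;>
    constructor <;> linarith

theorem mem_interior_convexBody {μ c : ℝ} {X : V4} (hμ0 : 0 ≤ μ)
    (hX : X 0 ^ 2 + X 1 ^ 2 < discS (2 * μ) / 200) (hK : Kham μ c X < 0) :
    X ∈ interior (convexBody μ c) := by
  rw [mem_interior_iff_mem_nhds]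
  have h1 : ∀ᶠ Y : V4 in nhds X, Y 0 ^ 2 + Y 1 ^ 2 < discS (2 * μ) / 200 :=
    ContinuousAt.eventually_lt (f := fun Y : V4 => Y 0 ^ 2 + Y 1 ^ 2) (by fun_prop)
      continuousAt_const hX
  have h2 : ∀ᶠ Y : V4 in nhds X, Kham μ c Y < 0 :=
    (continuousAt_Kham (mem_LCDom hμ0 hX.le)).eventually_lt continuousAt_const hK
  filter_upwards [h1, h2] with Y hY1 hY2 using ⟨hY1.le, hY2.le⟩

theorem frontier_convexBody {μ c : ℝ} (hμ0 : 0 ≤ μ) (hμ1 : μ ≤ 1 / 2) (hc : 21 / 10 ≤ c) :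
    frontier (convexBody μ c) =
      {X | X 0 ^ 2 + X 1 ^ 2 < discS (2 * μ) / 200 ∧ Kham μ c X = 0} := by
  rw [(isClosed_convexBody c hμ0).frontier_eq]
  ext X
  constructor
  · rintro ⟨⟨hX, hXK⟩, hinterior⟩
    have hlt : X 0 ^ 2 + X 1 ^ 2 < discS (2 * μ) / 200 :=
      lt_of_le_of_ne hX fun h => (Kham_pos_of_eq hμ0 hμ1 hc h).not_ge hXK
    exact ⟨hlt, le_antisymm hXK
      (not_lt.1 fun h => hinterior (mem_interior_convexBody hμ0 hlt h))⟩
  · rintro ⟨hX, hXK⟩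
    refine ⟨⟨hX.le, hXK.le⟩, fun hinterior => ?_⟩
    obtain ⟨d, hd1, hd2⟩ : ∃ d : ℝ, d ^ 2 = 1 ∧ 0 ≤ d * (X 2 + shift₁ μ (X 0) (X 1)) := by
      rcases le_total 0 (X 2 + shift₁ μ (X 0) (X 1)) with h | h
      · exact ⟨1, by norm_num, by linarith⟩
      · exact ⟨-1, by norm_num, by linarith⟩
    have hcont : ContinuousAt (fun ε : ℝ => (![X 0, X 1, X 2 + ε * d, X 3] : V4)) 0 := by
      refine continuousAt_pi.2 fun i => ?_
      fin_cases i <;> simp <;> fun_prop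
    have h0 : (![X 0, X 1, X 2 + 0 * d, X 3] : V4) = X := by
      ext i; fin_cases i <;> simp
    have hmem : convexBody μ c ∈
        nhds ((fun ε : ℝ => (![X 0, X 1, X 2 + ε * d, X 3] : V4)) 0) := by
      simp only [h0]
      exact mem_interior_iff_mem_nhds.1 hinterior
    have hev := hcont.eventually hmem
    obtain ⟨ε, hε, hεpos⟩ :=
      ((hev.filter_mono nhdsWithin_le_nhds).and (self_mem_nhdsWithin (s := Ioi (0 : ℝ)))).exists
    have hK := Kham_nonpos_iff.1 hε.2
    have hK0 := two_mul_Kham μ c X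
    simp only [Matrix.cons_val] at hK
    have hpos : (0 : ℝ) < ε := hεpos
    have hsq : (ε * d) ^ 2 = ε ^ 2 := by rw [mul_pow, hd1, mul_one]
    nlinarith [mul_nonneg hpos.le hd2, mul_pos hpos hpos]

theorem isPreconnected_frontier_of_convex {C : Set V4} (hC : Convex ℝ C)
    (hne : (interior C).Nonempty) (hb : Bornology.IsBounded C) : IsPreconnected (frontier C) := by
  obtain ⟨h, -, -, hfr⟩ := exists_homeomorph_image_interior_closure_frontier_eq_unitBall hC hne hb
  have hsph : IsConnected (Metric.sphere (0 : V4) 1) := by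
    refine isConnected_sphere ?_ 0 zero_le_one
    rw [rank_fun']
    norm_num
  rw [← h.isPreconnected_image, hfr]
  exact hsph.isPreconnected

end convexBody

/-- For every `μ ∈ [0,0.5]` and `c ∈ [2.1, 2.1+10⁻⁶]`, the hypersurface
`Σ_{μ,c}` is the boundary of a compact convex subset of `ℝ⁴ ≅ ℂ²` with nonempty interior. -/
theorem statement12 (μ c : ℝ) (hμ : μ ∈ Set.Icc (0:ℝ) 0.5)
    (hc : c ∈ Set.Icc (2.1:ℝ) (2.1 + 1/1000000)) :
    ∃ C : Set V4, Convex ℝ C ∧ IsCompact C ∧ (interior C).Nonempty ∧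
      SigmaLC μ c = frontier C := by
  have hμ0 : 0 ≤ μ := hμ.1
  have hμ1 : μ ≤ 1 / 2 := hμ.2.trans (by norm_num)
  have hc' : 21 / 10 ≤ c := le_trans (by norm_num) hc.1
  have hS : 0 < discS (2 * μ) / 200 := by unfold discS; nlinarith
  have hconv := convex_convexBody hμ0 hμ1 hc'
  have hcomp := isCompact_convexBody hμ0 hμ1 hc'
  have hinterior : (interior (convexBody μ c)).Nonempty := by
    refine ⟨0, mem_interior_convexBody hμ0 (by simpa using hS) ?_⟩
    simp [Kham]
    linarith
  have hfr := frontier_convexBody hμ0 hμ1 hc'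
  have hbase : (![0, 0, √(1 - μ), 0] : V4) ∈ frontier (convexBody μ c) := by
    rw [hfr]
    refine ⟨by simpa using hS, ?_⟩
    simp [Kham, Real.sq_sqrt (show 0 ≤ 1 - μ by linarith)]
    ring
  have hsub : frontier (convexBody μ c) ⊆ {x : V4 | x ∈ LCDom ∧ Kham μ c x = 0} := by
    rw [hfr]
    exact fun X hX => ⟨mem_LCDom hμ0 hX.1.le, hX.2⟩
  refine ⟨convexBody μ c, hconv, hcomp, hinterior, Subset.antisymm ?_ ?_⟩
  · have hcover : SigmaLC μ c ⊆ {X : V4 | X 0 ^ 2 + X 1 ^ 2 < discS (2 * μ) / 200} ∪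
        {X : V4 | discS (2 * μ) / 200 < X 0 ^ 2 + X 1 ^ 2} := by
      intro X hX
      rcases lt_trichotomy (X 0 ^ 2 + X 1 ^ 2) (discS (2 * μ) / 200) with h | h | h
      · exact Or.inl h
      · exact absurd (connectedComponentIn_subset _ _ hX).2 (Kham_pos_of_eq hμ0 hμ1 hc' h).ne'
      · exact Or.inr h
    have hleft : SigmaLC μ c ⊆ {X : V4 | X 0 ^ 2 + X 1 ^ 2 < discS (2 * μ) / 200} := by
      refine IsPreconnected.subset_left_of_subset_union
        (isOpen_lt (by fun_prop) (by fun_prop)) (isOpen_lt (by fun_prop) (by fun_prop))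
        ?_ hcover ⟨_, mem_connectedComponentIn (hsub hbase), by simpa using hS⟩
        isPreconnected_connectedComponentIn
      exact Set.disjoint_left.2 fun X (h1 : X 0 ^ 2 + X 1 ^ 2 < _)
        (h2 : _ < X 0 ^ 2 + X 1 ^ 2) => lt_asymm h1 h2
    rw [hfr]
    exact fun X hX => ⟨hleft hX, (connectedComponentIn_subset _ _ hX).2⟩
  · exact (isPreconnected_frontier_of_convex hconv hinterior
      hcomp.isBounded).subset_connectedComponentIn
      hbase hsub
end
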